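/- arXiv:1504.05159 — 5 statements merged into one kernel-verified Lean document; each statement's English description precedes it below -/
import Mathlib

section
/- For m, n ≥ 6, let K = L_m(a,b,-) be the language of the DFA D_m(a,b,c) restricted to the alphabet {a,b} (letter c removed), and let L = L_n(-,b,a) be the language over {a,b} of the DFA on Q_n with initial state 0, final state set {1}, where letter a induces (0→n−1)(1,…,n−2) and letter b induces (2→n−1)(1→2)(0→1)(3,4). Then κ(K ∪ L) = κ(K ⊕ L) = mn − (m+n−2) (union and symmetric difference), κ(K ∩ L) = mn − 2(m+n−3) (intersection), and κ(K \ L) = mn − (m+2n−4) (difference). -/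
/-- The left quotient of a language `L` by a word `w`: `w⁻¹L = {x | wx ∈ L}`. -/
def leftQuot {α : Type} (w : List α) (L : Set (List α)) : Set (List α) := {x | w ++ x ∈ L}

/-- The quotient complexity of a language: the number of its distinct left quotients. -/
noncomputable def quotComp {α : Type} (L : Set (List α)) : ℕ :=
  {K : Set (List α) | ∃ w : List α, K = leftQuot w L}.ncard

/-- A language is suffix-free if `v ∈ L` and `uv ∈ L` imply `u = ε`. -/
def SuffixFree {α : Type} (L : Set (List α)) : Prop :=
  ∀ u v : List α, v ∈ L → u ++ v ∈ L → u = []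

/-- The language accepted by a DFA. -/
def acceptsSet {α Q : Type} (M : DFA α Q) : Set (List α) :=
  {w | M.evalFrom M.start w ∈ M.accept}

/-- A language is regular if it is accepted by some DFA with finitely many states. -/
def RegularLang {α : Type} (L : Set (List α)) : Prop :=
  ∃ (Q : Type) (_ : Fintype Q) (M : DFA α Q), acceptsSet M = L

/-- The language of a state `q` of a DFA. -/
def stateLang {α Q : Type} (M : DFA α Q) (q : Q) : Set (List α) :=
  {w | M.evalFrom q w ∈ M.accept}

/-- A DFA is minimal if every state is reachable and no two distinct states have
the same language. -/
def MinimalDFA {α Q : Type} (M : DFA α Q) : Prop :=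
  (∀ q : Q, ∃ w : List α, M.evalFrom M.start w = q) ∧
    ∀ p q : Q, stateLang M p = stateLang M q → p = q

/-- The transition semigroup of a DFA: the transformations induced by nonempty words. -/
def transSemigroup {α Q : Type} (M : DFA α Q) : Set (Q → Q) :=
  {t | ∃ w : List α, w ≠ [] ∧ t = fun q => M.evalFrom q w}

/-- Product (concatenation) of two languages. -/
def catLang {α : Type} (K L : Set (List α)) : Set (List α) :=
  {w | ∃ u ∈ K, ∃ v ∈ L, w = u ++ v}

/-- Kleene star of a language. -/
def starLang {α : Type} (L : Set (List α)) : Set (List α) :=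
  {w | ∃ ws : List (List α), (∀ u ∈ ws, u ∈ L) ∧ w = ws.flatten}

/-- Reversal of a language. -/
def revLang {α : Type} (L : Set (List α)) : Set (List α) := {w | w.reverse ∈ L}
/-- Transformation `a : (0→n−1)(1,2,3)(4,…,n−2)`. -/
def aD (n : ℕ) (hn : 6 ≤ n) : Fin n → Fin n := fun q =>
  if q.val = 0 then ⟨n - 1, by omega⟩
  else if q.val = 1 then ⟨2, by omega⟩
  else if q.val = 2 then ⟨3, by omega⟩
  else if q.val = 3 then ⟨1, by omega⟩
  else if _h1 : q.val = n - 2 then ⟨4, by omega⟩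
  else if _h2 : q.val = n - 1 then q
  else ⟨q.val + 1, by have := q.isLt; omega⟩

/-- Transformation `b : (2→n−1)(1→2)(0→1)(3,4)`. -/
def bD (n : ℕ) (hn : 6 ≤ n) : Fin n → Fin n := fun q =>
  if q.val = 0 then ⟨1, by omega⟩
  else if q.val = 1 then ⟨2, by omega⟩
  else if q.val = 2 then ⟨n - 1, by omega⟩
  else if q.val = 3 then ⟨4, by omega⟩
  else if q.val = 4 then ⟨3, by omega⟩
  else q

/-- Transformation `c : (0→n−1)(1,…,n−2)`. -/
def cD (n : ℕ) (hn : 6 ≤ n) : Fin n → Fin n := fun q =>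
  if q.val = 0 then ⟨n - 1, by omega⟩
  else if _h1 : q.val = n - 2 then ⟨1, by omega⟩
  else if _h2 : q.val = n - 1 then q
  else ⟨q.val + 1, by have := q.isLt; omega⟩

/-- The DFA of `L_m(a,b,-)`: the DFA `D_m(a,b,c)` restricted to `{a,b}`
(encoded as `Fin 2`, `a = 0`, `b = 1`), initial state `0`, final state `1`. -/
def D11K (m : ℕ) (hm : 6 ≤ m) : DFA (Fin 2) (Fin m) where
  step := fun q x => if x = 0 then aD m hm q else bD m hm q
  start := ⟨0, by omega⟩
  accept := {⟨1, by omega⟩}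

/-- The DFA of `L_n(-,b,a)`: letter `a` induces `(0→n−1)(1,…,n−2)` and letter `b`
induces `(2→n−1)(1→2)(0→1)(3,4)`; initial state `0`, final state `1`. -/
def D11L (n : ℕ) (hn : 6 ≤ n) : DFA (Fin 2) (Fin n) where
  step := fun q x => if x = 0 then cD n hn q else bD n hn q
  start := ⟨0, by omega⟩
  accept := {⟨1, by omega⟩}

namespace S11

def aN (n q : ℕ) : ℕ :=
  if q = 0 then n - 1 else if q = 1 then 2 else if q = 2 then 3 else if q = 3 then 1
  else if q = n - 2 then 4 else if q = n - 1 then q else q + 1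

def bN (n q : ℕ) : ℕ :=
  if q = 0 then 1 else if q = 1 then 2 else if q = 2 then n - 1 else if q = 3 then 4
  else if q = 4 then 3 else q

def cN (n q : ℕ) : ℕ :=
  if q = 0 then n - 1 else if q = n - 2 then 1 else if q = n - 1 then q else q + 1

lemma aD_val (n : ℕ) (hn : 6 ≤ n) (q : Fin n) : (aD n hn q).val = aN n q.val := by
  unfold aD aN; split_ifs <;> rfl
lemma bD_val (n : ℕ) (hn : 6 ≤ n) (q : Fin n) : (bD n hn q).val = bN n q.val := by
  unfold bD bN; split_ifs <;> rfl
lemma cD_val (n : ℕ) (hn : 6 ≤ n) (q : Fin n) : (cD n hn q).val = cN n q.val := by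
  unfold cD cN; split_ifs <;> rfl

/-- Abstract connectivity. -/
lemma T_all (m n : ℕ) (hm : 6 ≤ m) (hn : 6 ≤ n) (T : ℕ → ℕ → Prop)
    (ha : ∀ p q, 1 ≤ p → p ≤ m - 2 → 1 ≤ q → q ≤ n - 2 → (T p q ↔ T (aN m p) (cN n q)))
    (hb : ∀ p q, 3 ≤ p → p ≤ m - 2 → 3 ≤ q → q ≤ n - 2 → (T p q ↔ T (bN m p) (bN n q)))
    (h11 : T 1 1) :
    ∀ p q, 1 ≤ p → p ≤ m - 2 → 1 ≤ q → q ≤ n - 2 → T p q := by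
  obtain ⟨M, rfl⟩ : ∃ M, m = M + 6 := ⟨m - 6, by omega⟩
  obtain ⟨N, rfl⟩ : ∃ N, n = N + 6 := ⟨n - 6, by omega⟩
  -- cycle lengths M+1, N+4
  have cstep : ∀ j, cN (N + 6) (1 + j % (N + 4)) = 1 + (j + 1) % (N + 4) := by
    intro j
    have h1 : j % (N + 4) < N + 4 := Nat.mod_lt _ (by omega)
    rw [← Nat.mod_add_mod]
    unfold cN
    by_cases h : j % (N + 4) = N + 3
    · rw [h, Nat.mod_self, if_neg (by omega), if_pos (by omega)]
    · rw [Nat.mod_eq_of_lt (show j % (N + 4) + 1 < N + 4 by omega)]; split_ifs <;> omega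
  have astep2 : ∀ i, aN (M + 6) (4 + i % (M + 1)) = 4 + (i + 1) % (M + 1) := by
    intro j
    have h1 : j % (M + 1) < M + 1 := Nat.mod_lt _ (by omega)
    rw [← Nat.mod_add_mod]
    unfold aN
    by_cases h : j % (M + 1) = M
    · rw [h, Nat.mod_self]; split_ifs <;> omega
    · rw [Nat.mod_eq_of_lt (show j % (M + 1) + 1 < M + 1 by omega)]; split_ifs <;> omega
  have astep1 : ∀ i, aN (M + 6) (1 + i % 3) = 1 + (i + 1) % 3 := by
    intro i
    unfold aN; split_ifs <;> omega
  -- generic shift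
  have shift : ∀ S : ℕ → ℕ → Prop, (∀ i j, S i j ↔ S (i + 1) (j + 1)) →
      ∀ k i j, S i j ↔ S (i + k) (j + k) := by
    intro S h k
    induction k with
    | zero => intro i j; rfl
    | succ k ih => intro i j; rw [ih i j, h]; rfl
  set U : ℕ → ℕ → Prop := fun i j => T (4 + i % (M + 1)) (1 + j % (N + 4)) with hU
  set S : ℕ → ℕ → Prop := fun i j => T (1 + i % 3) (1 + j % (N + 4)) with hS
  have Ustep : ∀ i j, U i j ↔ U (i + 1) (j + 1) := by
    intro i j
    have h1 : j % (N + 4) < N + 4 := Nat.mod_lt _ (by omega)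
    have h2 : i % (M + 1) < M + 1 := Nat.mod_lt _ (by omega)
    simp only [hU]
    rw [ha _ _ (by omega) (by omega) (by omega) (by omega), cstep, astep2]
  have Sstep : ∀ i j, S i j ↔ S (i + 1) (j + 1) := by
    intro i j
    have h1 : j % (N + 4) < N + 4 := Nat.mod_lt _ (by omega)
    have h2 : i % 3 < 3 := Nat.mod_lt _ (by omega)
    simp only [hS]
    rw [ha _ _ (by omega) (by omega) (by omega) (by omega), cstep, astep1]
  have Ush := shift U Ustep
  have Ssh := shift S Sstep
  have UN : ∀ i j k, U i (j + (N + 4) * k) ↔ U i j := by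
    intro i j k; simp only [hU, Nat.add_mul_mod_self_left]
  have SN : ∀ i j k, S i (j + (N + 4) * k) ↔ S i j := by
    intro i j k; simp only [hS, Nat.add_mul_mod_self_left]
  have UF : ∀ i j, U i j ↔ U (i + (N + 3) * j) 0 := by
    intro i j
    rw [Ush ((N + 3) * j) i j, ← UN _ 0 j, show 0 + (N + 4) * j = j + (N + 3) * j by ring]
  have SF : ∀ i j, S i j ↔ S (i + (N + 3) * j) 0 := by
    intro i j
    rw [Ssh ((N + 3) * j) i j, ← SN _ 0 j, show 0 + (N + 4) * j = j + (N + 3) * j by ring]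
  have UM : ∀ i, U i 0 ↔ U (i % (M + 1)) 0 := by
    intro i; simp only [hU, Nat.mod_mod]
  have Ub : ∀ i, 1 ≤ i → i ≤ M → (U i 2 ↔ U i 3) := by
    intro i h1 h2
    simp only [hU]
    rw [Nat.mod_eq_of_lt (show i < M + 1 by omega), Nat.mod_eq_of_lt (show 2 < N + 4 by omega),
      Nat.mod_eq_of_lt (show 3 < N + 4 by omega), hb _ _ (by omega) (by omega) (by omega) (by omega)]
    have e1 : bN (M + 6) (4 + i) = 4 + i := by unfold bN; split_ifs <;> omega
    rw [e1]; rfl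
  have U2 : ∀ i, U i 2 ↔ U (i + (N + 2)) 0 := by
    intro i
    rw [Ush (N + 2) i 2, ← UN _ 0 1, show 0 + (N + 4) * 1 = 2 + (N + 2) by ring]
  have U3 : ∀ i, U i 3 ↔ U (i + (N + 1)) 0 := by
    intro i
    rw [Ush (N + 1) i 3, ← UN _ 0 1, show 0 + (N + 4) * 1 = 3 + (N + 1) by ring]
  have Ut : ∀ t, t ≤ M → (U (N + 2 + t) 0 ↔ U (N + 2) 0) := by
    intro t
    induction t with
    | zero => intro _; rfl
    | succ t ih =>
      intro h
      rw [← ih (by omega), show N + 2 + (t + 1) = (t + 1) + (N + 2) by ring, ← U2,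
        Ub _ (by omega) h, U3, show t + 1 + (N + 1) = N + 2 + t by ring]
  have Uc0 : ∀ d, U d 0 ↔ U (N + 2) 0 := by
    intro d
    obtain ⟨t, ht, h⟩ : ∃ t, t ≤ M ∧ (N + 2 + t) % (M + 1) = d % (M + 1) := by
      refine ⟨(d + M * (N + 2)) % (M + 1), ?_, ?_⟩
      · have := Nat.mod_lt (d + M * (N + 2)) (show 0 < M + 1 by omega); omega
      · rw [Nat.add_mod_mod, show N + 2 + (d + M * (N + 2)) = d + (M + 1) * (N + 2) by ring,
          Nat.add_mul_mod_self_left]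
    rw [UM d, ← h, ← UM, Ut t ht]
  have Uc : ∀ i j, U i j ↔ U (N + 2) 0 := fun i j => by rw [UF, Uc0]
  have S3 : ∀ i, S i 0 ↔ S (i % 3) 0 := by
    intro i; simp only [hS, Nat.mod_mod]
  have e3 : bN (M + 6) 3 = 4 := rfl
  have S22 : S 2 2 ↔ U 0 3 := by
    simp only [hS, hU]
    rw [Nat.mod_eq_of_lt (show 2 < N + 4 by omega),
      Nat.mod_eq_of_lt (show 3 < N + 4 by omega), hb _ _ (by omega) (by omega) (by omega) (by omega),
      Nat.zero_mod]
    rfl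
  have S23 : S 2 3 ↔ U 0 2 := by
    simp only [hS, hU]
    rw [Nat.mod_eq_of_lt (show 2 < N + 4 by omega),
      Nat.mod_eq_of_lt (show 3 < N + 4 by omega), hb _ _ (by omega) (by omega) (by omega) (by omega),
      Nat.zero_mod]
    rfl
  have S24 : 1 ≤ N → (S 2 4 ↔ U 0 4) := by
    intro hN
    simp only [hS, hU]
    rw [Nat.mod_eq_of_lt (show 4 < N + 4 by omega), hb _ _ (by omega) (by omega) (by omega) (by omega),
      Nat.zero_mod]
    rfl
  have SP : ∀ i k, S (i + (N + 4)  * k) 0 ↔ S i 0 := by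
    intro i k
    rw [Ssh ((N + 4) * k) i 0, SN]
  have g0 : S (N + 4) 0 ↔ U (N + 2) 0 := by
    rw [← Uc 0 3, ← S22, Ssh (N + 2) 2 2, ← SN _ 0 1]
    rw [show 0 + (N + 4) * 1 = 2 + (N + 2) by ring, show 2 + (N + 2) = N + 4 by ring]
  have g1 : S (N + 3) 0 ↔ U (N + 2) 0 := by
    rw [← Uc 0 2, ← S23, Ssh (N + 1) 2 3, ← SN _ 0 1]
    rw [show 0 + (N + 4) * 1 = 3 + (N + 1) by ring, show 2 + (N + 1) = N + 3 by ring]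
  have g2 : S (N + 2) 0 ↔ U (N + 2) 0 := by
    rcases Nat.eq_zero_or_pos N with rfl | hN
    · rw [← g1, S3 (0 + 3), ← SP (0 + 2) 1, S3 _]
    · rw [← Uc 0 4, ← S24 hN, Ssh N 2 4, ← SN _ 0 1]
      rw [show 0 + (N + 4) * 1 = 4 + N by ring, show 2 + N = N + 2 by ring]
  have Sc0 : ∀ d, S d 0 ↔ U (N + 2) 0 := by
    intro d
    rw [S3 d]
    rw [S3] at g0 g1 g2
    have : d % 3 = (N + 4) % 3 ∨ d % 3 = (N + 3) % 3 ∨ d % 3 = (N + 2) % 3 := by omega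
    rcases this with h | h | h <;> rw [h] <;> assumption
  have Sc : ∀ i j, S i j ↔ U (N + 2) 0 := fun i j => by rw [SF, Sc0]
  have base : U (N + 2) 0 := by
    rw [← Sc 0 0]; simpa [hS] using h11
  intro p q hp hp' hq hq'
  by_cases h : p ≤ 3
  · have := (Sc (p - 1) (q - 1)).2 base
    simp only [hS] at this
    rwa [Nat.mod_eq_of_lt (show p - 1 < 3 by omega),
      Nat.mod_eq_of_lt (show q - 1 < N + 4 by omega), show 1 + (p - 1) = p by omega,
      show 1 + (q - 1) = q by omega] at this
  · have := (Uc (p - 4) (q - 1)).2 base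
    simp only [hU] at this
    rwa [Nat.mod_eq_of_lt (show p - 4 < M + 1 by omega),
      Nat.mod_eq_of_lt (show q - 1 < N + 4 by omega), show 4 + (p - 4) = p by omega,
      show 1 + (q - 1) = q by omega] at this

structure Good {n : ℕ} (M : DFA (Fin 2) (Fin n)) : Prop where
  n6 : 6 ≤ n
  pos : ∀ q x, 1 ≤ q.val → 1 ≤ (M.step q x).val
  sink : ∀ q x, q.val = n - 1 → (M.step q x).val = n - 1
  inj : ∀ q q' x, 1 ≤ q.val → 1 ≤ q'.val → M.step q x = M.step q' x →
    (M.step q x).val ≠ n - 1 → q = q'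
  amid : ∀ q, 1 ≤ q.val → q.val ≤ n - 2 → (M.step q 0).val ≤ n - 2
  b : ∀ q, (M.step q 1).val = bN n q.val
  a0 : ∀ q, q.val = 0 → (M.step q 0).val = n - 1
  start : M.start.val = 0
  acc : ∀ q, q ∈ M.accept ↔ q.val = 1

lemma K0 (m : ℕ) (hm : 6 ≤ m) (q : Fin m) : ((D11K m hm).step q 0).val = aN m q.val := by
  simp [D11K, aD_val]
lemma K1 (m : ℕ) (hm : 6 ≤ m) (q : Fin m) : ((D11K m hm).step q 1).val = bN m q.val := by
  simp [D11K, bD_val]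
lemma L0 (m : ℕ) (hm : 6 ≤ m) (q : Fin m) : ((D11L m hm).step q 0).val = cN m q.val := by
  simp [D11L, cD_val]
lemma L1 (m : ℕ) (hm : 6 ≤ m) (q : Fin m) : ((D11L m hm).step q 1).val = bN m q.val := by
  simp [D11L, bD_val]

lemma fin2 (x : Fin 2) : x = 0 ∨ x = 1 := by omega

lemma bN_bN (m p : ℕ) (hp : 3 ≤ p) : bN m (bN m p) = p := by
  by_cases h3 : p = 3
  · subst h3; rfl
  by_cases h4 : p = 4
  · subst h4; rfl
  have : bN m p = p := by unfold bN; split_ifs <;> omega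
  rw [this, this]

lemma bN_inj (m p q : ℕ) (hm : 6 ≤ m) (hp : p < m) (hq : q < m) (h1 : 1 ≤ p) (h2 : 1 ≤ q)
    (h : bN m p = bN m q) (h' : bN m p ≠ m - 1) : p = q := by
  unfold bN at *; split_ifs at * <;> omega
lemma aN_inj (m p q : ℕ) (hm : 6 ≤ m) (hp : p < m) (hq : q < m) (h1 : 1 ≤ p) (h2 : 1 ≤ q)
    (h : aN m p = aN m q) (h' : aN m p ≠ m - 1) : p = q := by
  unfold aN at *; split_ifs at * <;> omega
lemma cN_inj (m p q : ℕ) (hm : 6 ≤ m) (hp : p < m) (hq : q < m) (h1 : 1 ≤ p) (h2 : 1 ≤ q)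
    (h : cN m p = cN m q) (h' : cN m p ≠ m - 1) : p = q := by
  unfold cN at *; split_ifs at * <;> omega

lemma goodK (m : ℕ) (hm : 6 ≤ m) : Good (D11K m hm) where
  n6 := hm
  pos q x h := by
    rcases fin2 x with rfl | rfl
    · rw [K0]; unfold aN; split_ifs <;> omega
    · rw [K1]; unfold bN; split_ifs <;> omega
  sink q x h := by
    rcases fin2 x with rfl | rfl
    · rw [K0, h]; unfold aN; split_ifs <;> omega
    · rw [K1, h]; unfold bN; split_ifs <;> omega
  inj q q' x h h' e hs := by
    have e' := congrArg Fin.val e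
    apply Fin.ext
    rcases fin2 x with rfl | rfl
    · rw [K0, K0] at e'; rw [K0] at hs
      exact aN_inj m _ _ hm q.2 q'.2 h h' e' hs
    · rw [K1, K1] at e'; rw [K1] at hs
      exact bN_inj m _ _ hm q.2 q'.2 h h' e' hs
  amid q h h' := by rw [K0]; unfold aN; split_ifs <;> omega
  b q := K1 m hm q
  a0 q h := by rw [K0, h]; rfl
  start := rfl
  acc q := Iff.trans Set.mem_singleton_iff Fin.ext_iff

lemma goodL (m : ℕ) (hm : 6 ≤ m) : Good (D11L m hm) where
  n6 := hm
  pos q x h := by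
    rcases fin2 x with rfl | rfl
    · rw [L0]; unfold cN; split_ifs <;> omega
    · rw [L1]; unfold bN; split_ifs <;> omega
  sink q x h := by
    rcases fin2 x with rfl | rfl
    · rw [L0, h]; unfold cN; split_ifs <;> omega
    · rw [L1, h]; unfold bN; split_ifs <;> omega
  inj q q' x h h' e hs := by
    have e' := congrArg Fin.val e
    apply Fin.ext
    rcases fin2 x with rfl | rfl
    · rw [L0, L0] at e'; rw [L0] at hs
      exact cN_inj m _ _ hm q.2 q'.2 h h' e' hs
    · rw [L1, L1] at e'; rw [L1] at hs
      exact bN_inj m _ _ hm q.2 q'.2 h h' e' hs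
  amid q h h' := by rw [L0]; unfold cN; split_ifs <;> omega
  b q := L1 m hm q
  a0 q h := by rw [L0, h]; rfl
  start := rfl
  acc q := Iff.trans Set.mem_singleton_iff Fin.ext_iff

def Reach {m n : ℕ} (A : DFA (Fin 2) (Fin m)) (B : DFA (Fin 2) (Fin n))
    (x y : Fin m × Fin n) : Prop :=
  ∃ w, A.evalFrom x.1 w = y.1 ∧ B.evalFrom x.2 w = y.2

lemma Reach.rfl' {m n : ℕ} {A : DFA (Fin 2) (Fin m)} {B : DFA (Fin 2) (Fin n)}
    (x : Fin m × Fin n) : Reach A B x x := ⟨[], rfl, rfl⟩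

lemma Reach.tr {m n : ℕ} {A : DFA (Fin 2) (Fin m)} {B : DFA (Fin 2) (Fin n)}
    {x y z : Fin m × Fin n} (h : Reach A B x y) (h' : Reach A B y z) : Reach A B x z := by
  obtain ⟨w, h1, h2⟩ := h
  obtain ⟨v, h3, h4⟩ := h'
  exact ⟨w ++ v, by rw [DFA.evalFrom_of_append, h1, h3], by rw [DFA.evalFrom_of_append, h2, h4]⟩

lemma Reach.one {m n : ℕ} {A : DFA (Fin 2) (Fin m)} {B : DFA (Fin 2) (Fin n)}
    (x : Fin m × Fin n) (l : Fin 2) : Reach A B x (A.step x.1 l, B.step x.2 l) :=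
  ⟨[l], rfl, rfl⟩

def Mid {n : ℕ} (q : Fin n) : Prop := 1 ≤ q.val ∧ q.val ≤ n - 2

lemma reach_back {m n : ℕ} {A : DFA (Fin 2) (Fin m)} {B : DFA (Fin 2) (Fin n)}
    (gA : Good A) (gB : Good B) (x : Fin m × Fin n) (h1 : Mid x.1) (h2 : Mid x.2) :
    Reach A B (A.step x.1 0, B.step x.2 0) x := by
  let X := {x : Fin m × Fin n // Mid x.1 ∧ Mid x.2}
  let f : X → X := fun x => ⟨(A.step x.1.1 0, B.step x.1.2 0),
    ⟨gA.pos _ _ x.2.1.1, gA.amid _ x.2.1.1 x.2.1.2⟩, ⟨gB.pos _ _ x.2.2.1, gB.amid _ x.2.2.1 x.2.2.2⟩⟩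
  have f_inj : Function.Injective f := by
    intro u v h
    have h' := congrArg Subtype.val h
    have ha := congrArg Prod.fst h'
    have hb := congrArg Prod.snd h'
    have n1 := (f u).2.1.2
    have n2 := (f u).2.2.2
    have := gA.n6
    have := gB.n6
    apply Subtype.ext
    refine Prod.ext (gA.inj _ _ 0 u.2.1.1 v.2.1.1 ha ?_) (gB.inj _ _ 0 u.2.2.1 v.2.2.1 hb ?_)
    · change (A.step u.1.1 0).val ≤ _ at n1
      omega
    · change (B.step u.1.2 0).val ≤ _ at n2
      omega
  have hit : ∀ k (y : X), Reach A B y.1 (f^[k] y).1 := by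
    intro k
    induction k with
    | zero => intro y; exact Reach.rfl' _
    | succ k ih => intro y; exact (Reach.one y.1 0).tr (ih (f y))
  obtain ⟨k, hk, hp⟩ := f_inj.mem_periodicPts ⟨x, h1, h2⟩
  obtain ⟨k, rfl⟩ : ∃ j, k = j + 1 := ⟨k - 1, by omega⟩
  have h := hit k (f ⟨x, h1, h2⟩)
  have e : f^[k] (f ⟨x, h1, h2⟩) = ⟨x, h1, h2⟩ := hp
  rw [e] at h
  exact h

def Conn {m n : ℕ} (A : DFA (Fin 2) (Fin m)) (B : DFA (Fin 2) (Fin n)) : Prop :=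
  ∀ x y : Fin m × Fin n, Mid x.1 → Mid x.2 → Mid y.1 → Mid y.2 → Reach A B x y

lemma Conn.swap {m n : ℕ} {A : DFA (Fin 2) (Fin m)} {B : DFA (Fin 2) (Fin n)}
    (h : Conn A B) : Conn B A := by
  intro x y h1 h2 h3 h4
  obtain ⟨w, h5, h6⟩ := h x.swap y.swap h2 h1 h4 h3
  exact ⟨w, h6, h5⟩

lemma conn (m n : ℕ) (hm : 6 ≤ m) (hn : 6 ≤ n) : Conn (D11K m hm) (D11L n hn) := by
  have gA := goodK m hm
  have gB := goodL n hn
  set A := D11K m hm with hA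
  set B := D11L n hn with hB
  let o : Fin m × Fin n := (⟨1, by omega⟩, ⟨1, by omega⟩)
  let T : ℕ → ℕ → Prop := fun p q => ∀ (P : Fin m) (Q : Fin n), P.val = p → Q.val = q →
    Reach A B o (P, Q) ∧ Reach A B (P, Q) o
  have key : ∀ (p q p' q' : ℕ) (P : Fin m) (Q : Fin n) (P' : Fin m) (Q' : Fin n), P.val = p →
      Q.val = q → P'.val = p' → Q'.val = q' → Reach A B (P, Q) (P', Q') →
      Reach A B (P', Q') (P, Q) → (T p q ↔ T p' q') := by
    intro p q p' q' P Q P' Q' e1 e2 e3 e4 r1 r2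
    constructor
    · intro h P1 Q1 e5 e6
      obtain rfl : P1 = P' := Fin.ext (by omega)
      obtain rfl : Q1 = Q' := Fin.ext (by omega)
      obtain ⟨h1, h2⟩ := h P Q e1 e2
      exact ⟨h1.tr r1, r2.tr h2⟩
    · intro h P1 Q1 e5 e6
      obtain rfl : P1 = P := Fin.ext (by omega)
      obtain rfl : Q1 = Q := Fin.ext (by omega)
      obtain ⟨h1, h2⟩ := h P' Q' e3 e4
      exact ⟨h1.tr r2, r1.tr h2⟩
  have hT := T_all m n hm hn T ?_ ?_ ?_
  · intro x y h1 h2 h3 h4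
    exact (hT _ _ h1.1 h1.2 h2.1 h2.2 x.1 x.2 rfl rfl).2.tr
      (hT _ _ h3.1 h3.2 h4.1 h4.2 y.1 y.2 rfl rfl).1
  · intro p q h1 h2 h3 h4
    refine key p q _ _ ⟨p, by omega⟩ ⟨q, by omega⟩ (A.step ⟨p, by omega⟩ 0)
      (B.step ⟨q, by omega⟩ 0) rfl rfl (K0 _ _ _) (L0 _ _ _) (Reach.one _ 0) ?_
    exact reach_back gA gB (⟨p, by omega⟩, ⟨q, by omega⟩) ⟨h1, h2⟩ ⟨h3, h4⟩
  · intro p q h1 h2 h3 h4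
    refine key p q _ _ ⟨p, by omega⟩ ⟨q, by omega⟩ (A.step ⟨p, by omega⟩ 1)
      (B.step ⟨q, by omega⟩ 1) rfl rfl (K1 _ _ _) (L1 _ _ _) (Reach.one _ 1) ?_
    refine ⟨[1], ?_, ?_⟩
    · apply Fin.ext
      change (A.step (A.step ⟨p, _⟩ 1) 1).val = p
      rw [gA.b, gA.b]
      exact bN_bN m p h1
    · apply Fin.ext
      change (B.step (B.step ⟨q, _⟩ 1) 1).val = q
      rw [gB.b, gB.b]
      exact bN_bN n q h3
  · intro P Q e1 e2
    obtain rfl : P = o.1 := Fin.ext e1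
    obtain rfl : Q = o.2 := Fin.ext e2
    exact ⟨Reach.rfl' _, Reach.rfl' _⟩

lemma Good.sinkw {n : ℕ} {M : DFA (Fin 2) (Fin n)} (g : Good M) (w : List (Fin 2)) :
    ∀ q : Fin n, q.val = n - 1 → (M.evalFrom q w).val = n - 1 := by
  induction w with
  | nil => intro q h; exact h
  | cons x w ih => intro q h; exact ih _ (g.sink q x h)

lemma Good.posw {n : ℕ} {M : DFA (Fin 2) (Fin n)} (g : Good M) (w : List (Fin 2)) :
    ∀ q : Fin n, 1 ≤ q.val → 1 ≤ (M.evalFrom q w).val := by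
  induction w with
  | nil => intro q h; exact h
  | cons x w ih => intro q h; exact ih _ (g.pos q x h)

lemma Good.injw {n : ℕ} {M : DFA (Fin 2) (Fin n)} (g : Good M) (w : List (Fin 2)) :
    ∀ q q' : Fin n, 1 ≤ q.val → 1 ≤ q'.val → (M.evalFrom q w).val = 1 →
      (M.evalFrom q' w).val = 1 → q = q' := by
  induction w with
  | nil => intro q q' _ _ h h'; exact Fin.ext (by rw [DFA.evalFrom_nil] at h h'; omega)
  | cons x w ih =>
    intro q q' h1 h2 h h'
    have e := ih _ _ (g.pos q x h1) (g.pos q' x h2) h h'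
    refine g.inj q q' x h1 h2 e ?_
    intro hs
    have := g.sinkw w _ hs
    change (M.evalFrom (M.step q x) w).val = 1 at h
    have := g.n6
    omega

lemma Good.mid_or {n : ℕ} {M : DFA (Fin 2) (Fin n)} (g : Good M) (q : Fin n) (h : 1 ≤ q.val) :
    Mid q ∨ q.val = n - 1 := by
  have := q.2
  unfold Mid; omega

lemma kill {m n : ℕ} {A : DFA (Fin 2) (Fin m)} {B : DFA (Fin 2) (Fin n)}
    (gA : Good A) (gB : Good B) (hc : Conn A B) (p : Fin m) (hp : Mid p) :
    ∃ w, (A.evalFrom p w).val = 1 ∧ ∀ q : Fin n, 1 ≤ q.val → (B.evalFrom q w).val = n - 1 := by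
  have m6 := gA.n6
  have n6 := gB.n6
  have hs : ∀ s : Finset (Fin n), ∃ w, Mid (A.evalFrom p w) ∧
      ∀ q ∈ s, 1 ≤ q.val → (B.evalFrom q w).val = n - 1 := by
    intro s
    induction s using Finset.induction_on with
    | empty => exact ⟨[], hp, by simp⟩
    | insert q s _ ih =>
      obtain ⟨w, h1, h2⟩ := ih
      by_cases hq : 1 ≤ q.val
      · rcases gB.mid_or _ (gB.posw w q hq) with h | h
        · obtain ⟨v, h3, h4⟩ := hc (A.evalFrom p w, B.evalFrom q w)
            (⟨3, by omega⟩, ⟨2, by omega⟩) h1 h ⟨by simp, by simp; omega⟩ ⟨by simp, by simp; omega⟩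
          simp only at h3 h4
          refine ⟨w ++ (v ++ [1]), ?_, ?_⟩
          · rw [DFA.evalFrom_of_append, DFA.evalFrom_of_append, h3]
            change Mid (A.step _ 1)
            unfold Mid
            rw [gA.b]; simp [bN]; omega
          · intro q' hq' h5
            rw [DFA.evalFrom_of_append]
            rcases Finset.mem_insert.1 hq' with rfl | h6
            · rw [DFA.evalFrom_of_append, h4]
              change (B.step _ 1).val = _
              rw [gB.b]; simp [bN]
            · exact gB.sinkw _ _ (h2 q' h6 h5)
        · refine ⟨w, h1, ?_⟩
          intro q' hq' h5
          rcases Finset.mem_insert.1 hq' with rfl | h6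
          · exact h
          · exact h2 q' h6 h5
      · refine ⟨w, h1, ?_⟩
        intro q' hq' h5
        rcases Finset.mem_insert.1 hq' with rfl | h6
        · exact absurd h5 hq
        · exact h2 q' h6 h5
  obtain ⟨w, h1, h2⟩ := hs Finset.univ
  obtain ⟨v, h3, h4⟩ := hc (A.evalFrom p w, ⟨1, by omega⟩)
            (⟨1, by omega⟩, ⟨1, by omega⟩) h1 ⟨by simp, by simp; omega⟩
            ⟨by simp, by simp; omega⟩ ⟨by simp, by simp; omega⟩
  refine ⟨w ++ v, ?_, ?_⟩
  · rw [DFA.evalFrom_of_append]; simp only at h3; rw [h3]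
  · intro q hq
    rw [DFA.evalFrom_of_append]
    exact gB.sinkw _ _ (h2 q (Finset.mem_univ _) hq)

def RS (m n : ℕ) : Set (Fin m × Fin n) :=
  {x | (x.1.val = 0 ∧ x.2.val = 0) ∨ (1 ≤ x.1.val ∧ 1 ≤ x.2.val)}

/-- from a middle pair, reach (mid, sink). -/
lemma reach_half {m n : ℕ} {A : DFA (Fin 2) (Fin m)} {B : DFA (Fin 2) (Fin n)}
    (gA : Good A) (gB : Good B) (hc : Conn A B) (x y : Fin m × Fin n)
    (h1 : Mid x.1) (h2 : Mid x.2) (h3 : Mid y.1) (h4 : y.2.val = n - 1) : Reach A B x y := by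
  have m6 := gA.n6
  have n6 := gB.n6
  obtain ⟨w, h5, h6⟩ := kill gA gB hc x.1 h1
  obtain ⟨v, h7, h8⟩ := hc (A.evalFrom x.1 w, ⟨1, by omega⟩) (y.1, ⟨1, by omega⟩)
    ⟨by simp only; omega, by simp only; omega⟩ ⟨by simp, by simp; omega⟩ h3 ⟨by simp, by simp; omega⟩
  refine ⟨w ++ v, ?_, ?_⟩
  · rw [DFA.evalFrom_of_append]; exact h7
  · rw [DFA.evalFrom_of_append]
    exact Fin.ext (by rw [gB.sinkw _ _ (h6 _ h2.1), h4])

lemma Reach.swap {m n : ℕ} {A : DFA (Fin 2) (Fin m)} {B : DFA (Fin 2) (Fin n)}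
    {x y : Fin m × Fin n} (h : Reach B A x.swap y.swap) : Reach A B x y := by
  obtain ⟨w, h1, h2⟩ := h
  exact ⟨w, h2, h1⟩

lemma reach_iff {m n : ℕ} {A : DFA (Fin 2) (Fin m)} {B : DFA (Fin 2) (Fin n)}
    (gA : Good A) (gB : Good B) (hc : Conn A B) (y : Fin m × Fin n) :
    Reach A B (A.start, B.start) y ↔ y ∈ RS m n := by
  have m6 := gA.n6
  have n6 := gB.n6
  have r0 := Reach.one (A := A) (B := B) (A.start, B.start) 0
  have r1 := Reach.one (A := A) (B := B) (A.start, B.start) 1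
  have ea : (A.step A.start 0).val = m - 1 := gA.a0 _ gA.start
  have eb : (B.step B.start 0).val = n - 1 := gB.a0 _ gB.start
  have ea1 : (A.step A.start 1).val = 1 := by rw [gA.b, gA.start]; rfl
  have eb1 : (B.step B.start 1).val = 1 := by rw [gB.b, gB.start]; rfl
  constructor
  · rintro ⟨w, h1, h2⟩
    simp only at h1 h2
    rw [← Prod.mk.eta (p := y), ← h1, ← h2]
    cases w with
    | nil => exact Or.inl ⟨gA.start, gB.start⟩
    | cons x w =>
      refine Or.inr ⟨gA.posw w (A.step A.start x) ?_, gB.posw w (B.step B.start x) ?_⟩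
      · rcases fin2 x with rfl | rfl <;> omega
      · rcases fin2 x with rfl | rfl <;> omega
  · rintro (⟨h1, h2⟩ | ⟨h1, h2⟩)
    · have : y = (A.start, B.start) :=
        Prod.ext (Fin.ext (by rw [h1, gA.start])) (Fin.ext (by rw [h2, gB.start]))
      rw [this]; exact Reach.rfl' _
    · have mA : Mid (A.step A.start 1) := ⟨by omega, by omega⟩
      have mB : Mid (B.step B.start 1) := ⟨by omega, by omega⟩
      rcases gA.mid_or _ h1 with h3 | h3 <;> rcases gB.mid_or _ h2 with h4 | h4
      · exact r1.tr (hc _ _ mA mB h3 h4)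
      · exact r1.tr (reach_half gA gB hc _ _ mA mB h3 h4)
      · exact r1.tr (Reach.swap (reach_half gB gA hc.swap _ _ mB mA h4 h3))
      · have : y = (A.step A.start 0, B.step B.start 0) :=
          Prod.ext (Fin.ext (by rw [h3, ea])) (Fin.ext (by rw [h4, eb]))
        rw [this]; exact r0

def lang {m n : ℕ} (A : DFA (Fin 2) (Fin m)) (B : DFA (Fin 2) (Fin n)) (op : Prop → Prop → Prop)
    (x : Fin m × Fin n) : Set (List (Fin 2)) :=
  {w | op ((A.evalFrom x.1 w).val = 1) ((B.evalFrom x.2 w).val = 1)}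

lemma count {m n : ℕ} {A : DFA (Fin 2) (Fin m)} {B : DFA (Fin 2) (Fin n)}
    (gA : Good A) (gB : Good B) (hc : Conn A B) (op : Prop → Prop → Prop)
    (J : Set (List (Fin 2))) (hJ : J = lang A B op (A.start, B.start)) (C : Set (Fin m × Fin n))
    (hC : C ⊆ RS m n) (hsurj : ∀ x ∈ RS m n, ∃ y ∈ C, lang A B op x = lang A B op y)
    (hinj : ∀ x ∈ C, ∀ y ∈ C, x ≠ y → lang A B op x ≠ lang A B op y) :
    quotComp J = C.ncard := by
  have hq : ∀ w, leftQuot w J = lang A B op (A.evalFrom A.start w, B.evalFrom B.start w) := by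
    intro w
    subst hJ
    ext v
    simp [leftQuot, lang, DFA.evalFrom_of_append]
  have : {K : Set (List (Fin 2)) | ∃ w, K = leftQuot w J} = lang A B op '' C := by
    ext K
    constructor
    · rintro ⟨w, rfl⟩
      rw [hq]
      obtain ⟨y, hy, e⟩ := hsurj (A.evalFrom A.start w, B.evalFrom B.start w)
        ((reach_iff gA gB hc _).1 ⟨w, rfl, rfl⟩)
      exact ⟨y, hy, e.symm⟩
    · rintro ⟨y, hy, rfl⟩
      obtain ⟨w, h1, h2⟩ := (reach_iff gA gB hc _).2 (hC hy)
      refine ⟨w, ?_⟩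
      rw [hq]
      simp only at h1 h2
      rw [h1, h2]
  unfold quotComp
  rw [this, Set.InjOn.ncard_image]
  intro x hx y hy h
  by_contra hne
  exact hinj x hx y hy hne h

lemma lang_ne {m n : ℕ} {A : DFA (Fin 2) (Fin m)} {B : DFA (Fin 2) (Fin n)}
    {op : Prop → Prop → Prop} {x y : Fin m × Fin n} (w : List (Fin 2)) (h : w ∈ lang A B op x)
    (h' : w ∉ lang A B op y) : lang A B op x ≠ lang A B op y :=
  fun e => h' (e ▸ h)

lemma sepA {m n : ℕ} {A : DFA (Fin 2) (Fin m)} {B : DFA (Fin 2) (Fin n)}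
    (gA : Good A) (gB : Good B) (hc : Conn A B) (op : Prop → Prop → Prop)
    (hTF : op True False) (hFF : ¬ op False False) (x y : Fin m × Fin n)
    (hx1 : 1 ≤ x.1.val) (hx2 : 1 ≤ x.2.val) (hy1 : 1 ≤ y.1.val) (hy2 : 1 ≤ y.2.val)
    (hne : x.1 ≠ y.1) : lang A B op x ≠ lang A B op y := by
  have m6 := gA.n6
  have n6 := gB.n6
  have main : ∀ x y : Fin m × Fin n, Mid x.1 → 1 ≤ x.2.val → 1 ≤ y.1.val → 1 ≤ y.2.val →
      x.1 ≠ y.1 → lang A B op x ≠ lang A B op y := by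
    intro x y hx1 hx2 hy1 hy2 hne
    obtain ⟨w, h1, h2⟩ := kill gA gB hc x.1 hx1
    have e1 := h2 _ hx2
    have e2 := h2 _ hy2
    have e3 : (A.evalFrom y.1 w).val ≠ 1 := fun h => hne (gA.injw w _ _ hx1.1 hy1 h1 h)
    have n1 : ¬ (n - 1 = 1) := by omega
    refine lang_ne w ?_ ?_
    · simp only [lang, Set.mem_setOf_eq, h1, e1, n1]; exact hTF
    · simp only [lang, Set.mem_setOf_eq, e3, e2, n1]; exact hFF
  rcases gA.mid_or _ hx1 with h | h
  · exact main x y h hx2 hy1 hy2 hne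
  · rcases gA.mid_or _ hy1 with h' | h'
    · exact (main y x h' hy2 hx1 hx2 hne.symm).symm
    · exact absurd (Fin.ext (h.trans h'.symm)) hne

lemma lang_swap {m n : ℕ} (A : DFA (Fin 2) (Fin m)) (B : DFA (Fin 2) (Fin n))
    (op : Prop → Prop → Prop) (x : Fin m × Fin n) :
    lang A B op x = lang B A (fun a b => op b a) x.swap := rfl

lemma alive1 {m n : ℕ} {A : DFA (Fin 2) (Fin m)} {B : DFA (Fin 2) (Fin n)}
    (gA : Good A) (gB : Good B) (hc : Conn A B) (op : Prop → Prop → Prop)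
    (hTF : op True False) (x : Fin m × Fin n)
    (hx1 : Mid x.1) (hx2 : 1 ≤ x.2.val) : (lang A B op x).Nonempty := by
  have n6 := gB.n6
  obtain ⟨w, h1, h2⟩ := kill gA gB hc x.1 hx1
  have e1 := h2 _ hx2
  have n1 : ¬ (n - 1 = 1) := by omega
  refine ⟨w, ?_⟩
  simp only [lang, Set.mem_setOf_eq, h1, e1, n1]; exact hTF

lemma mid_step {n : ℕ} {M : DFA (Fin 2) (Fin n)} (g : Good M) (q : Fin n) (h : Mid q) :
    Mid (M.step q 0) := ⟨g.pos _ _ h.1, g.amid _ h.1 h.2⟩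

lemma mid_one {n : ℕ} {M : DFA (Fin 2) (Fin n)} (g : Good M) : Mid (M.step M.start 1) := by
  have := g.n6
  unfold Mid
  rw [g.b, g.start]
  change 1 ≤ 1 ∧ 1 ≤ n - 2
  omega

lemma zero_ne {m n : ℕ} {A : DFA (Fin 2) (Fin m)} {B : DFA (Fin 2) (Fin n)}
    (gA : Good A) (gB : Good B) (op : Prop → Prop → Prop) (hFF : ¬ op False False)
    (P : Fin m × Fin n → Prop) (hP : ∀ x, P x → (lang A B op x).Nonempty)
    (hs : ∀ x, P x → P (A.step x.1 0, B.step x.2 0))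
    (h1 : P (A.step A.start 1, B.step B.start 1)) (y : Fin m × Fin n)
    (hy : P y ∨ (y.1.val = m - 1 ∧ y.2.val = n - 1)) :
    lang A B op y ≠ lang A B op (A.start, B.start) := by
  have m6 := gA.n6
  have n6 := gB.n6
  have n1 : ¬ (n - 1 = 1) := by omega
  have m1 : ¬ (m - 1 = 1) := by omega
  have sk : ∀ (y : Fin m × Fin n) w, y.1.val = m - 1 → y.2.val = n - 1 → w ∉ lang A B op y := by
    intro y w h1 h2
    simp only [lang, Set.mem_setOf_eq, gA.sinkw w _ h1, gB.sinkw w _ h2, n1, m1]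
    exact hFF
  rcases hy with hy | hy
  · obtain ⟨w, hw⟩ := hP _ (hs _ hy)
    refine lang_ne (0 :: w) hw ?_
    exact sk (A.step A.start 0, B.step B.start 0) w (gA.a0 _ gA.start) (gB.a0 _ gB.start)
  · obtain ⟨w, hw⟩ := hP _ h1
    exact (lang_ne (1 :: w) hw (sk y (1 :: w) hy.1 hy.2)).symm

lemma card_pos (n : ℕ) (hn : 6 ≤ n) : {p : Fin n | 1 ≤ p.val}.ncard = n - 1 := by
  have : {p : Fin n | 1 ≤ p.val} = {(⟨0, by omega⟩ : Fin n)}ᶜ := by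
    ext p; simp only [Set.mem_setOf_eq, Set.mem_compl_iff, Set.mem_singleton_iff, Fin.ext_iff]; omega
  rw [this, Set.ncard_compl, Set.ncard_singleton, Nat.card_fin]

lemma card_mid (n : ℕ) (hn : 6 ≤ n) : {p : Fin n | Mid p}.ncard = n - 2 := by
  have : {p : Fin n | Mid p} = {(⟨0, by omega⟩ : Fin n), ⟨n - 1, by omega⟩}ᶜ := by
    ext p
    have := p.2
    simp only [Mid, Set.mem_setOf_eq, Set.mem_compl_iff, Set.mem_insert_iff,
      Set.mem_singleton_iff, Fin.ext_iff]; omega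
  rw [this, Set.ncard_compl, Set.ncard_pair, Nat.card_fin]
  simp only [ne_eq, Fin.ext_iff]; omega

lemma count2 {m n : ℕ} {A : DFA (Fin 2) (Fin m)} {B : DFA (Fin 2) (Fin n)}
    (gA : Good A) (gB : Good B) (hc : Conn A B) (op : Prop → Prop → Prop) (hFF : ¬ op False False)
    (J : Set (List (Fin 2))) (hJ : J = lang A B op (A.start, B.start)) (C : Set (Fin m × Fin n))
    (hC : ∀ x ∈ C, 1 ≤ x.1.val ∧ 1 ≤ x.2.val)
    (hsurj : ∀ x : Fin m × Fin n, 1 ≤ x.1.val → 1 ≤ x.2.val →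
      ∃ y ∈ C, lang A B op x = lang A B op y)
    (P : Fin m × Fin n → Prop) (hP : ∀ x, P x → (lang A B op x).Nonempty)
    (hs : ∀ x, P x → P (A.step x.1 0, B.step x.2 0))
    (h1 : P (A.step A.start 1, B.step B.start 1))
    (hCP : ∀ x ∈ C, P x ∨ (x.1.val = m - 1 ∧ x.2.val = n - 1))
    (hinj : ∀ x ∈ C, ∀ y ∈ C, x ≠ y → lang A B op x ≠ lang A B op y) :
    quotComp J = C.ncard + 1 := by
  rw [← Set.ncard_insert_of_notMem (a := (A.start, B.start)) (s := C)]
  · apply count gA gB hc op J hJ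
    · rintro x (rfl | h)
      · exact Or.inl ⟨gA.start, gB.start⟩
      · exact Or.inr (hC x h)
    · rintro x (⟨h2, h3⟩ | ⟨h2, h3⟩)
      · refine ⟨_, Set.mem_insert _ _, ?_⟩
        rw [show x = (A.start, B.start) from
          Prod.ext (Fin.ext (by rw [h2, gA.start])) (Fin.ext (by rw [h3, gB.start]))]
      · obtain ⟨y, hy, e⟩ := hsurj x h2 h3
        exact ⟨y, Set.mem_insert_of_mem _ hy, e⟩
    · rintro x (rfl | hx) y (rfl | hy) hne
      · exact absurd rfl hne
      · exact (zero_ne gA gB op hFF P hP hs h1 y (hCP y hy)).symm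
      · exact zero_ne gA gB op hFF P hP hs h1 x (hCP x hx)
      · exact hinj x hx y hy hne
  · intro h
    have h2 := (hC _ h).1
    have h3 := gA.start
    simp only at h2
    omega

lemma case_union {m n : ℕ} {A : DFA (Fin 2) (Fin m)} {B : DFA (Fin 2) (Fin n)}
    (gA : Good A) (gB : Good B) (hc : Conn A B) (op : Prop → Prop → Prop) (hFF : ¬ op False False)
    (hTF : op True False) (hFT : op False True)
    (J : Set (List (Fin 2))) (hJ : J = lang A B op (A.start, B.start)) :
    quotComp J = (m - 1) * (n - 1) + 1 := by
  rw [← card_pos m gA.n6, ← card_pos n gB.n6, ← Set.ncard_prod]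
  refine count2 gA gB hc op hFF J hJ _ (fun x hx => hx) (fun x h h' => ⟨x, ⟨h, h'⟩, rfl⟩)
    (fun x => (Mid x.1 ∧ 1 ≤ x.2.val) ∨ (1 ≤ x.1.val ∧ Mid x.2)) ?_ ?_
    (Or.inl ⟨mid_one gA, (mid_one gB).1⟩) ?_ ?_
  · rintro x (⟨h, h'⟩ | ⟨h, h'⟩)
    · exact alive1 gA gB hc op hTF x h h'
    · exact alive1 gB gA hc.swap (fun a b => op b a) hFT x.swap h' h
  · rintro x (⟨h, h'⟩ | ⟨h, h'⟩)
    · exact Or.inl ⟨mid_step gA _ h, gB.pos _ _ h'⟩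
    · exact Or.inr ⟨gA.pos _ _ h, mid_step gB _ h'⟩
  · rintro x ⟨h, h'⟩
    rcases gA.mid_or _ h with h1 | h1
    · exact Or.inl (Or.inl ⟨h1, h'⟩)
    · rcases gB.mid_or _ h' with h2 | h2
      · exact Or.inl (Or.inr ⟨h, h2⟩)
      · exact Or.inr ⟨h1, h2⟩
  · rintro x ⟨hx, hx'⟩ y ⟨hy, hy'⟩ hne
    by_cases h : x.1 = y.1
    · have h2 : x.2 ≠ y.2 := fun h2 => hne (Prod.ext h h2)
      exact sepA gB gA hc.swap (fun a b => op b a) hFT hFF x.swap y.swap hx' hx hy' hy h2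
    · exact sepA gA gB hc op hTF hFF x y hx hx' hy hy' h

lemma case_diff {m n : ℕ} {A : DFA (Fin 2) (Fin m)} {B : DFA (Fin 2) (Fin n)}
    (gA : Good A) (gB : Good B) (hc : Conn A B)
    (J : Set (List (Fin 2))) (hJ : J = lang A B (fun a b => a ∧ ¬ b) (A.start, B.start)) :
    quotComp J = (m - 2) * (n - 1) + 1 + 1 := by
  have m6 := gA.n6
  have n6 := gB.n6
  have n1 : ¬ (n - 1 = 1) := by omega
  have m1 : ¬ (m - 1 = 1) := by omega
  let s : Fin m × Fin n := (⟨m - 1, by omega⟩, ⟨n - 1, by omega⟩)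
  rw [← card_mid m gA.n6, ← card_pos n gB.n6, ← Set.ncard_prod,
    ← Set.ncard_insert_of_notMem (a := s)]
  swap
  · rintro ⟨h, _⟩
    have : m - 1 ≤ m - 2 := h.2
    omega
  have dead : ∀ x : Fin m × Fin n, x.1.val = m - 1 → lang A B (fun a b => a ∧ ¬ b) x = ∅ := by
    intro x hx
    ext w
    simp [lang, gA.sinkw w _ hx, m1]
  refine count2 gA gB hc _ (by simp) J hJ _ ?_ ?_
    (fun x => (Mid x.1 ∧ 1 ≤ x.2.val)) ?_ ?_ ⟨mid_one gA, (mid_one gB).1⟩ ?_ ?_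
  · rintro x (rfl | ⟨h, h'⟩)
    · constructor
      · change 1 ≤ m - 1; omega
      · change 1 ≤ n - 1; omega
    · exact ⟨h.1, h'⟩
  · intro x h h'
    rcases gA.mid_or _ h with h1 | h1
    · exact ⟨x, Or.inr ⟨h1, h'⟩, rfl⟩
    · exact ⟨s, Or.inl rfl, by rw [dead x h1, dead s rfl]⟩
  · rintro x ⟨h, h'⟩
    exact alive1 gA gB hc _ (by simp) x h h'
  · rintro x ⟨h, h'⟩
    exact ⟨mid_step gA _ h, gB.pos _ _ h'⟩
  · rintro x (rfl | ⟨h, h'⟩)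
    · exact Or.inr ⟨rfl, rfl⟩
    · exact Or.inl ⟨h, h'⟩
  · rintro x (rfl | ⟨hx, hx'⟩) y (rfl | ⟨hy, hy'⟩) hne
    · exact absurd rfl hne
    · rw [dead s rfl]
      exact (alive1 gA gB hc _ (by simp) y hy hy').ne_empty.symm
    · rw [dead s rfl]
      exact (alive1 gA gB hc _ (by simp) x hx hx').ne_empty
    · by_cases h : x.1 = y.1
      · have h2 : x.2 ≠ y.2 := fun h2 => hne (Prod.ext h h2)
        have main : ∀ x y : Fin m × Fin n, Mid x.1 → Mid x.2 → 1 ≤ y.2.val → x.1 = y.1 →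
            x.2 ≠ y.2 → lang A B (fun a b => a ∧ ¬ b) y ≠ lang A B (fun a b => a ∧ ¬ b) x := by
          intro x y h1 h2 h3 h4 h5
          obtain ⟨w, h6, h7⟩ := hc x (⟨1, by omega⟩, ⟨1, by omega⟩) h1 h2
            ⟨by simp, by simp; omega⟩ ⟨by simp, by simp; omega⟩
          have e6 := congrArg Fin.val h6
          have e7 := congrArg Fin.val h7
          simp only at e6 e7
          refine lang_ne w ?_ ?_
          · simp only [lang, Set.mem_setOf_eq]
            rw [← h4]
            exact ⟨e6, fun h => h5 (gB.injw w _ _ h2.1 h3 e7 h)⟩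
          · simp only [lang, Set.mem_setOf_eq]
            exact fun h => h.2 e7
        rcases gB.mid_or _ hx' with h3 | h3
        · exact (main x y hx h3 hy' h h2).symm
        · rcases gB.mid_or _ hy' with h4 | h4
          · exact main y x hy h4 hx' h.symm h2.symm
          · exact absurd (Fin.ext (h3.trans h4.symm)) h2
      · exact sepA gA gB hc _ (by simp) (by simp) x y hx.1 hx' hy.1 hy' h

lemma case_inter {m n : ℕ} {A : DFA (Fin 2) (Fin m)} {B : DFA (Fin 2) (Fin n)}
    (gA : Good A) (gB : Good B) (hc : Conn A B)
    (J : Set (List (Fin 2))) (hJ : J = lang A B And (A.start, B.start)) :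
    quotComp J = (m - 2) * (n - 2) + 1 + 1 := by
  have m6 := gA.n6
  have n6 := gB.n6
  have n1 : ¬ (n - 1 = 1) := by omega
  have m1 : ¬ (m - 1 = 1) := by omega
  let s : Fin m × Fin n := (⟨m - 1, by omega⟩, ⟨n - 1, by omega⟩)
  rw [← card_mid m gA.n6, ← card_mid n gB.n6, ← Set.ncard_prod,
    ← Set.ncard_insert_of_notMem (a := s)]
  swap
  · rintro ⟨h, _⟩
    have : m - 1 ≤ m - 2 := h.2
    omega
  have dead : ∀ x : Fin m × Fin n, x.1.val = m - 1 ∨ x.2.val = n - 1 → lang A B And x = ∅ := by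
    rintro x (hx | hx)
    · ext w
      simp [lang, gA.sinkw w _ hx, m1]
    · ext w
      simp [lang, gB.sinkw w _ hx, n1]
  have live : ∀ x : Fin m × Fin n, Mid x.1 → Mid x.2 → ∃ w, (A.evalFrom x.1 w).val = 1 ∧
      (B.evalFrom x.2 w).val = 1 := by
    intro x h1 h2
    obtain ⟨w, h6, h7⟩ := hc x (⟨1, by omega⟩, ⟨1, by omega⟩) h1 h2
            ⟨by simp, by simp; omega⟩ ⟨by simp, by simp; omega⟩
    exact ⟨w, congrArg Fin.val h6, congrArg Fin.val h7⟩
  refine count2 gA gB hc _ (by simp) J hJ _ ?_ ?_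
    (fun x => (Mid x.1 ∧ Mid x.2)) ?_ ?_ ⟨mid_one gA, mid_one gB⟩ ?_ ?_
  · rintro x (rfl | ⟨h, h'⟩)
    · constructor
      · change 1 ≤ m - 1; omega
      · change 1 ≤ n - 1; omega
    · exact ⟨h.1, h'.1⟩
  · intro x h h'
    rcases gA.mid_or _ h with h1 | h1
    · rcases gB.mid_or _ h' with h2 | h2
      · exact ⟨x, Or.inr ⟨h1, h2⟩, rfl⟩
      · exact ⟨s, Or.inl rfl, by rw [dead x (Or.inr h2), dead s (Or.inl rfl)]⟩
    · exact ⟨s, Or.inl rfl, by rw [dead x (Or.inl h1), dead s (Or.inl rfl)]⟩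
  · rintro x ⟨h, h'⟩
    exact live x h h'
  · rintro x ⟨h, h'⟩
    exact ⟨mid_step gA _ h, mid_step gB _ h'⟩
  · rintro x (rfl | ⟨h, h'⟩)
    · exact Or.inr ⟨rfl, rfl⟩
    · exact Or.inl ⟨h, h'⟩
  · rintro x (rfl | ⟨hx, hx'⟩) y (rfl | ⟨hy, hy'⟩) hne
    · exact absurd rfl hne
    · rw [dead s (Or.inl rfl)]
      exact (Set.Nonempty.ne_empty (live y hy hy')).symm
    · rw [dead s (Or.inl rfl)]
      exact (Set.Nonempty.ne_empty (live x hx hx'))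
    · obtain ⟨w, h1, h2⟩ := live x hx hx'
      refine lang_ne w ⟨h1, h2⟩ ?_
      rintro ⟨h3, h4⟩
      exact hne (Prod.ext (gA.injw w _ _ hx.1 hy.1 h1 h3) (gB.injw w _ _ hx'.1 hy'.1 h2 h4))

lemma acc_mem {n : ℕ} {M : DFA (Fin 2) (Fin n)} (g : Good M) (w : List (Fin 2)) :
    w ∈ acceptsSet M ↔ (M.evalFrom M.start w).val = 1 := g.acc _

end S11

/-- For `m, n ≥ 6`, the languages `K = L_m(a,b,-)` and `L = L_n(-,b,a)` meet the
suffix-free bounds for the boolean operations: `mn − (m+n−2)` for union and symmetric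
difference, `mn − 2(m+n−3)` for intersection, and `mn − (m+2n−4)` for difference. -/
theorem stmt11 (m n : ℕ) (hm : 6 ≤ m) (hn : 6 ≤ n) :
    quotComp (acceptsSet (D11K m hm) ∪ acceptsSet (D11L n hn)) = m * n - (m + n - 2) ∧
    quotComp (symmDiff (acceptsSet (D11K m hm)) (acceptsSet (D11L n hn))) =
      m * n - (m + n - 2) ∧
    quotComp (acceptsSet (D11K m hm) ∩ acceptsSet (D11L n hn)) =
      m * n - 2 * (m + n - 3) ∧
    quotComp (acceptsSet (D11K m hm) \ acceptsSet (D11L n hn)) =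
      m * n - (m + 2 * n - 4) := by
  have gA := S11.goodK m hm
  have gB := S11.goodL n hn
  have hc := S11.conn m n hm hn
  refine ⟨?_, ?_, ?_, ?_⟩
  · rw [S11.case_union gA gB hc Or (by simp) (by simp) (by simp) _ (by
      ext w; simp only [Set.mem_union, S11.acc_mem gA, S11.acc_mem gB]; rfl)]
    obtain ⟨a, rfl⟩ : ∃ a, m = a + 6 := ⟨m - 6, by omega⟩
    obtain ⟨b, rfl⟩ : ∃ b, n = b + 6 := ⟨n - 6, by omega⟩
    simp only [Nat.add_sub_cancel, Nat.reduceSubDiff]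
    apply Nat.eq_sub_of_add_eq
    rw [show a + 6 + (b + 6) - 2 = a + b + 10 by omega]
    ring
  · rw [S11.case_union gA gB hc (fun a b => (a ∧ ¬ b) ∨ (b ∧ ¬ a)) (by simp) (by simp) (by simp) _ (by
      ext w; simp only [Set.mem_symmDiff, S11.acc_mem gA, S11.acc_mem gB]; rfl)]
    obtain ⟨a, rfl⟩ : ∃ a, m = a + 6 := ⟨m - 6, by omega⟩
    obtain ⟨b, rfl⟩ : ∃ b, n = b + 6 := ⟨n - 6, by omega⟩
    simp only [Nat.add_sub_cancel, Nat.reduceSubDiff]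
    apply Nat.eq_sub_of_add_eq
    rw [show a + 6 + (b + 6) - 2 = a + b + 10 by omega]
    ring
  · rw [S11.case_inter gA gB hc _ (by
      ext w; simp only [Set.mem_inter_iff, S11.acc_mem gA, S11.acc_mem gB]; rfl)]
    obtain ⟨a, rfl⟩ : ∃ a, m = a + 6 := ⟨m - 6, by omega⟩
    obtain ⟨b, rfl⟩ : ∃ b, n = b + 6 := ⟨n - 6, by omega⟩
    simp only [Nat.add_sub_cancel, Nat.reduceSubDiff]
    apply Nat.eq_sub_of_add_eq
    rw [show a + 6 + (b + 6) - 3 = a + b + 9 by omega]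
    ring
  · rw [S11.case_diff gA gB hc _ (by
      ext w; simp only [Set.mem_diff, S11.acc_mem gA, S11.acc_mem gB]; rfl)]
    obtain ⟨a, rfl⟩ : ∃ a, m = a + 6 := ⟨m - 6, by omega⟩
    obtain ⟨b, rfl⟩ : ∃ b, n = b + 6 := ⟨n - 6, by omega⟩
    simp only [Nat.add_sub_cancel, Nat.reduceSubDiff]
    apply Nat.eq_sub_of_add_eq
    rw [show a + 6 + 2 * (b + 6) - 4 = a + 2 * b + 14 by omega]
    ring
end

section
/- Let n ≥ 4 and let L be a suffix-free regular language whose minimal DFA is D = (Q_n, Σ, δ, 0, F) with initial state 0 and empty state n−1. If L meets the bound for reversal, i.e. κ(L^R) = 2^{n−2} + 1, then the transition semigroup of D is contained in Wsf(n). -/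
/-- `Bsf n`: transformations `t` of `Q_n = {0,…,n-1}` such that `0` is not in the range
of `t`, `(n-1)t = n-1`, and for every `j ≥ 1` either `0t^j = n-1` or `0t^j ≠ qt^j`
for all `q` with `0 < q < n-1`. -/
def Bsf (n : ℕ) (hn : 0 < n) : Set (Fin n → Fin n) :=
  {t | (∀ q : Fin n, t q ≠ ⟨0, hn⟩) ∧ t ⟨n - 1, by omega⟩ = ⟨n - 1, by omega⟩ ∧
    ∀ j : ℕ, 1 ≤ j →
      (t^[j] ⟨0, hn⟩ = ⟨n - 1, by omega⟩ ∨
        ∀ q : Fin n, 0 < q.val → q.val < n - 1 → t^[j] ⟨0, hn⟩ ≠ t^[j] q)}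

/-- `Vsf n`: members of `Bsf n` such that any two distinct states are either both
mapped to `n-1` or mapped to distinct states. -/
def Vsf (n : ℕ) (hn : 0 < n) : Set (Fin n → Fin n) :=
  {t | t ∈ Bsf n hn ∧ ∀ p q : Fin n, p ≠ q →
    (t p = ⟨n - 1, by omega⟩ ∧ t q = ⟨n - 1, by omega⟩) ∨ t p ≠ t q}

/-- `Wsf n`: members of `Bsf n` that either map `0` to `n-1` or map every
`q` with `1 ≤ q ≤ n-2` to `n-1`. -/
def Wsf (n : ℕ) (hn : 0 < n) : Set (Fin n → Fin n) :=
  {t | t ∈ Bsf n hn ∧ (t ⟨0, hn⟩ = ⟨n - 1, by omega⟩ ∨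
    ∀ q : Fin n, 1 ≤ q.val → q.val ≤ n - 2 → t q = ⟨n - 1, by omega⟩)}

/-- The (unordered) pair `{p,q}` of distinct states of `Q_n \ {0, n-1}` is colliding
in the set `T` of transformations. -/
def Colliding {n : ℕ} (hn : 0 < n) (T : Set (Fin n → Fin n)) (p q : Fin n) : Prop :=
  ∃ t ∈ T, ∃ r : Fin n, 0 < r.val ∧ r.val < n - 1 ∧
    ((t ⟨0, hn⟩ = p ∧ t r = q) ∨ (t ⟨0, hn⟩ = q ∧ t r = p))

/-- The semigroup of transformations generated by `G` under composition:
the least set containing `G` and closed under composition. -/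
def genSG {β : Type} (G : Set (β → β)) : Set (β → β) :=
  ⋂₀ {T : Set (β → β) | G ⊆ T ∧ ∀ f ∈ T, ∀ g ∈ T, (g ∘ f) ∈ T}

theorem aux_full {α : Type} (n : ℕ) (hn : 4 ≤ n) (M : DFA α (Fin n)) (z e : Fin n)
    (hz : z.val = 0) (he : e.val = n - 1)
    (h1 : ∀ w : List α, M.evalFrom e w ∉ M.accept)
    (h2 : ∀ w : List α, M.evalFrom z w ∈ M.accept →
      ∀ q : Fin n, q ≠ z → M.evalFrom q w ∉ M.accept)
    (hrev : quotComp (revLang (acceptsSet M)) = 2 ^ (n - 2) + 1) :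
    ∃ w : List α, ∀ q : Fin n, 0 < q.val → q.val < n - 1 → M.evalFrom q w ∈ M.accept := by
  classical
  let fam : Set (Set (Fin n)) := {S | ∃ w : List α, S = {q | M.evalFrom q w ∈ M.accept}}
  let A : Set (Fin n) := Set.Ioo z e
  let B : Set (Set (Fin n)) := insert {z} (𝒫 A)
  have hsub : fam ⊆ B := by
    rintro S ⟨w, rfl⟩
    by_cases h0 : M.evalFrom z w ∈ M.accept
    · left
      ext q
      simp only [Set.mem_ofPred_eq, Set.mem_singleton_iff]
      constructor
      · intro hq
        by_contra hne
        exact h2 w h0 q hne hq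
      · rintro rfl
        exact h0
    · right
      intro q hq
      simp only [Set.mem_ofPred_eq] at hq
      have a : q ≠ z := by rintro rfl; exact h0 hq
      have b : q ≠ e := by rintro rfl; exact h1 w hq
      simp only [ne_eq, Fin.ext_iff] at a b
      simp only [A, Set.mem_Ioo, Fin.lt_def]
      omega
  have hA : A.ncard = n - 2 := by
    have : A = ((Finset.Ioo z e : Finset (Fin n)) : Set (Fin n)) := by
      simp [A]
    rw [this, Set.ncard_coe_finset, Fin.card_Ioo]
    omega
  have hB : B.ncard ≤ 2 ^ (n - 2) + 1 := by
    refine (Set.ncard_insert_le _ _).trans ?_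
    rw [Set.ncard_powerset, hA]
  have hq : quotComp (revLang (acceptsSet M)) ≤ fam.ncard := by
    refine le_trans (Set.ncard_le_ncard ?_ (Set.toFinite _)) (Set.ncard_image_le (Set.toFinite fam)
      (f := fun S => {x : List α | M.evalFrom M.start x.reverse ∈ S}))
    rintro K ⟨w, rfl⟩
    refine ⟨_, ⟨w.reverse, rfl⟩, ?_⟩
    ext x
    simp [leftQuot, revLang, acceptsSet, DFA.evalFrom_of_append]
  have heq : fam = B := Set.eq_of_subset_of_ncard_le hsub (by omega) (Set.toFinite _)
  have hmem : A ∈ fam := by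
    rw [heq]
    right
    exact Set.Subset.rfl
  obtain ⟨w, hw⟩ := hmem
  refine ⟨w, fun q a b => ?_⟩
  have : q ∈ A := by
    simp only [A, Set.mem_Ioo, Fin.lt_def]
    omega
  rw [hw] at this
  exact this

theorem aux_iter {α Q : Type} (M : DFA α Q) (u : List α) (j : ℕ) :
    ∃ v : List α, ∀ q, (fun q => M.evalFrom q u)^[j] q = M.evalFrom q v := by
  induction j with
  | zero => exact ⟨[], fun q => rfl⟩
  | succ k ih =>
    obtain ⟨v, hv⟩ := ih
    refine ⟨v ++ u, fun q => ?_⟩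
    rw [Function.iterate_succ_apply', hv, DFA.evalFrom_of_append]

/-- If a suffix-free regular language with minimal DFA `M` on `Q_n` (initial state
`0`, empty state `n−1`) meets the bound `2^{n−2} + 1` for reversal, then the
transition semigroup of `M` is contained in `Wsf(n)`. -/
theorem stmt14 {α : Type} (n : ℕ) (hn : 4 ≤ n) (M : DFA α (Fin n))
    (hstart : M.start = ⟨0, by omega⟩) (hmin : MinimalDFA M)
    (hempty : stateLang M ⟨n - 1, by omega⟩ = ∅)
    (hsf : SuffixFree (acceptsSet M))
    (hrev : quotComp (revLang (acceptsSet M)) = 2 ^ (n - 2) + 1) :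
    transSemigroup M ⊆ Wsf n (by omega) := by
  have h1 : ∀ w : List α, M.evalFrom ⟨n - 1, by omega⟩ w ∉ M.accept := by
    intro w hw
    have : w ∈ stateLang M ⟨n - 1, by omega⟩ := hw
    rw [hempty] at this
    exact this
  have hne : ∀ q : Fin n, q ≠ ⟨n - 1, by omega⟩ → ∃ x, M.evalFrom q x ∈ M.accept := by
    intro q hq
    by_contra hcon
    push Not at hcon
    apply hq
    apply hmin.2
    rw [hempty]
    ext x
    simpa [stateLang] using hcon x
  have hreach : ∀ q : Fin n, ∃ w : List α, M.evalFrom ⟨0, by omega⟩ w = q := by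
    intro q
    have := hmin.1 q
    rwa [hstart] at this
  have hsf' : ∀ u v : List α, M.evalFrom ⟨0, by omega⟩ v ∈ M.accept →
      M.evalFrom (M.evalFrom ⟨0, by omega⟩ u) v ∈ M.accept → u = [] := by
    intro u v hv huv
    apply hsf u v
    · simpa [acceptsSet, hstart] using hv
    · simpa [acceptsSet, hstart, DFA.evalFrom_of_append] using huv
  have h2 : ∀ w : List α, M.evalFrom ⟨0, by omega⟩ w ∈ M.accept →
      ∀ q : Fin n, q ≠ ⟨0, by omega⟩ → M.evalFrom q w ∉ M.accept := by
    intro w hw q hq hqw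
    obtain ⟨v, rfl⟩ := hreach q
    have := hsf' v w hw hqw
    subst this
    exact hq rfl
  obtain ⟨w, hw⟩ := aux_full n hn M _ _ rfl rfl h1 h2 hrev
  rintro t ⟨u, hu, rfl⟩
  have hz : ∀ q : Fin n, M.evalFrom q u ≠ ⟨0, by omega⟩ := by
    intro q hq
    obtain ⟨v, rfl⟩ := hreach q
    obtain ⟨x, hx⟩ := hne ⟨0, by omega⟩ (by simp only [ne_eq, Fin.ext_iff]; omega)
    have := hsf' (v ++ u) x hx (by rw [DFA.evalFrom_of_append, hq]; exact hx)
    simp [hu] at this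
  refine ⟨⟨hz, ?_, ?_⟩, ?_⟩
  · by_contra hcon
    obtain ⟨x, hx⟩ := hne _ hcon
    rw [← DFA.evalFrom_of_append] at hx
    exact h1 _ hx
  · intro j _
    obtain ⟨v, hv⟩ := aux_iter M u j
    rw [hv]
    by_cases hc : M.evalFrom ⟨0, by omega⟩ v = ⟨n - 1, by omega⟩
    · exact Or.inl hc
    · right
      intro q q0 _ he
      rw [hv] at he
      obtain ⟨x, hx⟩ := hne _ hc
      refine h2 (v ++ x) ?_ q ?_ ?_
      · rw [DFA.evalFrom_of_append]; exact hx
      · rintro rfl; simp at q0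
      · rw [DFA.evalFrom_of_append, ← he]; exact hx
  · by_contra hcon
    push Not at hcon
    obtain ⟨hc, q, q1, q2, hq⟩ := hcon
    have key : ∀ p : Fin n, M.evalFrom p u ≠ ⟨n - 1, by omega⟩ →
        M.evalFrom p (u ++ w) ∈ M.accept := by
      intro p hp
      rw [DFA.evalFrom_of_append]
      have h0 := hz p
      simp only [ne_eq, Fin.ext_iff] at hp h0
      apply hw <;> omega
    exact h2 (u ++ w) (key _ hc) q (by rintro rfl; simp at q1) (key _ hq)
end

section
/- For n ≥ 4, let L be the language L_n(a,-,c,-,e) of the DFA over {a,c,e} on states Q_n with initial state 0, final states the odd states q with 0 < q < n−1, where a induces (0→n−1)(1,…,n−2), c induces (0→n−1)(n−2→1), and e induces (Q_n\{0}→n−1)(0→1). Then the reversal of L meets the bound for suffix-free languages: κ(L^R) = 2^{n−2} + 1. -/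
/-- Transformation `a : (0→n−1)(1,…,n−2)`. -/
def aT (n : ℕ) (hn : 4 ≤ n) : Fin n → Fin n := fun q =>
  if q.val = 0 then ⟨n - 1, by omega⟩
  else if _h1 : q.val = n - 2 then ⟨1, by omega⟩
  else if _h2 : q.val = n - 1 then q
  else ⟨q.val + 1, by have := q.isLt; omega⟩

/-- Transformation `b : (0→n−1)(1,2)`. -/
def bT (n : ℕ) (hn : 4 ≤ n) : Fin n → Fin n := fun q =>
  if q.val = 0 then ⟨n - 1, by omega⟩
  else if q.val = 1 then ⟨2, by omega⟩
  else if q.val = 2 then ⟨1, by omega⟩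
  else q

/-- Transformation `c : (0→n−1)(n−2→1)`. -/
def cT (n : ℕ) (hn : 4 ≤ n) : Fin n → Fin n := fun q =>
  if q.val = 0 then ⟨n - 1, by omega⟩
  else if q.val = n - 2 then ⟨1, by omega⟩
  else q

/-- Transformation `d : ({0,1}→n−1)`. -/
def dT (n : ℕ) (hn : 4 ≤ n) : Fin n → Fin n := fun q =>
  if q.val ≤ 1 then ⟨n - 1, by omega⟩ else q

/-- Transformation `e : (Q_n\{0}→n−1)(0→1)`. -/
def eT (n : ℕ) (hn : 4 ≤ n) : Fin n → Fin n := fun q =>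
  if q.val = 0 then ⟨1, by omega⟩ else ⟨n - 1, by omega⟩

/-- The DFA of `L_n(a,-,c,-,e)` over the alphabet `{a,c,e}` (encoded as `Fin 3`,
`a = 0`, `c = 1`, `e = 2`), with initial state `0` and final states the odd states
strictly between `0` and `n−1`. -/
def D15 (n : ℕ) (hn : 4 ≤ n) : DFA (Fin 3) (Fin n) where
  step := fun q x => if x = 0 then aT n hn q else if x = 1 then cT n hn q else eT n hn q
  start := ⟨0, by omega⟩
  accept := {q : Fin n | 0 < q.val ∧ q.val < n - 1 ∧ q.val % 2 = 1}

def R15 (n : ℕ) (hn : 4 ≤ n) (p : ℕ → Bool) : Prop :=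
  ∃ w : List (Fin 3), ∀ (i : ℕ) (hi : i < n - 2),
    (p i = true ↔ (D15 n hn).evalFrom ⟨i + 1, by omega⟩ w ∈ (D15 n hn).accept)

lemma R15.congr {n : ℕ} {hn : 4 ≤ n} {p q : ℕ → Bool} (h : R15 n hn p)
    (hpq : ∀ i < n - 2, q i = p i) : R15 n hn q := by
  obtain ⟨w, hw⟩ := h
  refine ⟨w, fun i hi => ?_⟩
  rw [hpq i hi]
  exact hw i hi

lemma R15.rot1 {n : ℕ} {hn : 4 ≤ n} {p : ℕ → Bool} (h : R15 n hn p) :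
    R15 n hn (fun i => p ((i + 1) % (n - 2))) := by
  obtain ⟨w, hw⟩ := h
  refine ⟨0 :: w, fun i hi => ?_⟩
  have hm := Nat.mod_lt (i + 1) (show 0 < n - 2 by omega)
  rw [DFA.evalFrom_cons]
  have : (D15 n hn).step ⟨i + 1, by omega⟩ 0 = ⟨(i + 1) % (n - 2) + 1, by omega⟩ := by
    simp only [D15, aT, if_true]
    by_cases h1 : i + 1 = n - 2
    · simp [h1]; omega
    · simp [h1, show i + 1 ≠ n - 1 by omega, Nat.mod_eq_of_lt (show i + 1 < n - 2 by omega)]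
  rw [this]
  exact hw _ hm

lemma R15.cop1 {n : ℕ} {hn : 4 ≤ n} {p : ℕ → Bool} (h : R15 n hn p) :
    R15 n hn (fun i => if i = n - 3 then p 0 else p i) := by
  obtain ⟨w, hw⟩ := h
  refine ⟨1 :: w, fun i hi => ?_⟩
  rw [DFA.evalFrom_cons]
  by_cases h1 : i = n - 3
  · have : (D15 n hn).step ⟨i + 1, by omega⟩ 1 = ⟨0 + 1, by omega⟩ := by
      simp [D15, cT, show i + 1 = n - 2 by omega]; omega
    rw [this]; simp only [if_pos h1]
    exact hw 0 (by omega)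
  · have : (D15 n hn).step ⟨i + 1, by omega⟩ 1 = ⟨i + 1, by omega⟩ := by
      simp [D15, cT, show i + 1 ≠ n - 2 by omega]
    rw [this]; simp only [if_neg h1]
    exact hw i hi

lemma R15.rot {n : ℕ} {hn : 4 ≤ n} {p : ℕ → Bool} (h : R15 n hn p) (k : ℕ) :
    R15 n hn (fun i => p ((i + k) % (n - 2))) := by
  induction k with
  | zero => exact h.congr fun i hi => by simp [Nat.mod_eq_of_lt hi]
  | succ k ih =>
    refine ih.rot1.congr fun i hi => ?_
    simp only [Nat.mod_add_mod]
    congr 2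
    omega

lemma R15.cop {n : ℕ} {hn : 4 ≤ n} {p : ℕ → Bool} (h : R15 n hn p) (j : ℕ) (hj : j < n - 2) :
    R15 n hn (fun i => if i = j then p ((j + 1) % (n - 2)) else p i) := by
  refine ((h.rot (j + 1)).cop1.rot (n - 3 - j)).congr fun i hi => ?_
  by_cases h1 : i = j
  · subst h1
    have : (i + (n - 3 - i)) % (n - 2) = n - 3 := by
      rw [Nat.mod_eq_of_lt] <;> omega
    simp [this]
  · have : (i + (n - 3 - j)) % (n - 2) ≠ n - 3 := by
      intro h2
      by_cases h3 : i < j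
      · rw [Nat.mod_eq_of_lt (by omega)] at h2; omega
      · rw [Nat.mod_eq_sub_mod (by omega), Nat.mod_eq_of_lt (by omega)] at h2; omega
    simp only [if_neg h1, if_neg this, Nat.mod_add_mod]
    rw [show i + (n - 3 - j) + (j + 1) = i + (n - 2) by omega, Nat.add_mod_right,
      Nat.mod_eq_of_lt hi]

lemma R15.dup {n : ℕ} {hn : 4 ≤ n} {p : ℕ → Bool} (h : R15 n hn p) (j : ℕ) :
    R15 n hn (fun i => if i ≤ j then p i else p (i - 1)) := by
  induction j with
  | zero =>
    refine ((h.rot (n - 3)).cop 0 (by omega)).congr fun i hi => ?_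
    by_cases h1 : i = 0
    · subst h1
      simp only [if_true, le_refl]
      rw [Nat.mod_eq_of_lt (show 0 + 1 < n - 2 by omega),
        show 0 + 1 + (n - 3) = n - 2 by omega, Nat.mod_self]
    · simp only [if_neg h1, if_neg (show ¬ i ≤ 0 by omega)]
      rw [Nat.mod_eq_sub_mod (by omega), Nat.mod_eq_of_lt (by omega)]
      congr 1; omega
  | succ j ih =>
    by_cases hj : j + 2 < n - 2
    · refine (ih.cop (j + 1) (by omega)).congr fun i hi => ?_
      rw [Nat.mod_eq_of_lt (by omega)]
      by_cases h1 : i = j + 1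
      · subst h1; simp
      · by_cases h2 : i ≤ j
        · simp [h1, h2, show i ≤ j + 1 by omega]
        · simp [h1, h2, show ¬ i ≤ j + 1 by omega]
    · exact h.congr fun i hi => by simp [show i ≤ j + 1 by omega]

lemma R15.alt {n : ℕ} {hn : 4 ≤ n} (k : ℕ) : ∀ (p : ℕ → Bool), p 0 = true →
    (∀ i, k ≤ i → i + 1 < n - 2 → p (i + 1) = !p i) → R15 n hn p := by
  induction k with
  | zero =>
    intro p h0 hp
    refine ⟨[], fun i hi => ?_⟩
    have : ∀ i < n - 2, (p i = true ↔ (i + 1) % 2 = 1) := by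
      intro i
      induction i with
      | zero => simp [h0]
      | succ i ih =>
        intro hi
        rw [hp i (by omega) hi]
        have := ih (by omega)
        cases hpi : p i <;> simp [hpi] at this ⊢ <;> omega
    rw [this i hi]
    simp only [DFA.evalFrom_nil, D15, Set.mem_setOf_eq]
    omega
  | succ k ih =>
    intro p h0 hp
    by_cases hk : p (k + 1) = p k ∧ k + 1 < n - 2
    · obtain ⟨hk, hkn⟩ := hk
      have hz : R15 n hn (fun i => if i ≤ k then p i else if i = n - 3 then !p (n - 3)
          else p (i + 1)) := by
        apply ih
        · simp [h0]
        · intro i hi hin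
          have e1 : ¬ i + 1 ≤ k := by omega
          simp only [if_neg e1]
          by_cases h1 : i ≤ k
          · have : i = k := by omega
            subst this
            simp only [le_refl, if_true, ← hk]
            split_ifs with h2
            · rw [h2]
            · exact hp (i + 1) (by omega) (by omega)
          · rw [if_neg h1, if_neg (show i ≠ n - 3 by omega)]
            split_ifs with h2
            · rw [h2]
            · exact hp (i + 1) (by omega) (by omega)
      refine (hz.dup k).congr fun i hi => ?_
      by_cases h1 : i ≤ k
      · simp [h1]
      · by_cases h2 : i = k + 1
        · subst h2; simp [hk]
        · simp only [if_neg h1, if_neg (show ¬ i - 1 ≤ k by omega),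
            if_neg (show i - 1 ≠ n - 3 by omega)]
          congr 1; omega
    · apply ih p h0
      intro i hi hin
      by_cases h1 : i = k
      · subst h1
        have : p (i + 1) ≠ p i := fun h => hk ⟨h, hin⟩
        cases h3 : p i <;> simp_all
      · exact hp i (by omega) hin

lemma R15.all {n : ℕ} {hn : 4 ≤ n} (p : ℕ → Bool) (i₀ : ℕ) (hi₀ : i₀ < n - 2)
    (h : p i₀ = true) : R15 n hn p := by
  have h1 : R15 n hn (fun i => p ((i + i₀) % (n - 2))) := by
    apply R15.alt n
    · simp [Nat.mod_eq_of_lt hi₀, h]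
    · intro i _ _; omega
  refine (h1.rot (n - 2 - i₀)).congr fun i hi => ?_
  simp only [Nat.mod_add_mod]
  rw [show i + (n - 2 - i₀) + i₀ = i + (n - 2) by omega, Nat.add_mod_right, Nat.mod_eq_of_lt hi]

def S15 (n : ℕ) (hn : 4 ≤ n) (w : List (Fin 3)) : Set (Fin n) :=
  {q | (D15 n hn).evalFrom q w ∈ (D15 n hn).accept}

lemma S15_cons (n : ℕ) (hn : 4 ≤ n) (x : Fin 3) (w : List (Fin 3)) (q : Fin n) :
    q ∈ S15 n hn (x :: w) ↔ (D15 n hn).step q x ∈ S15 n hn w := by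
  simp [S15, DFA.evalFrom_cons]

lemma S15_last (n : ℕ) (hn : 4 ≤ n) (w : List (Fin 3)) :
    (⟨n - 1, by omega⟩ : Fin n) ∉ S15 n hn w := by
  induction w with
  | nil => simp [S15, D15]
  | cons x w ih =>
    rw [S15_cons]
    have : (D15 n hn).step ⟨n - 1, by omega⟩ x = ⟨n - 1, by omega⟩ := by
      simp only [D15, aT, cT, eT]
      simp [show n - 1 ≠ 0 by omega, show n - 1 ≠ n - 2 by omega]
    rwa [this]

lemma S15_e (n : ℕ) (hn : 4 ≤ n) (w : List (Fin 3)) (q : Fin n) :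
    q ∈ S15 n hn (2 :: w) ↔ q.val = 0 ∧ (⟨1, by omega⟩ : Fin n) ∈ S15 n hn w := by
  rw [S15_cons]
  have := S15_last n hn w
  by_cases h : q.val = 0
  · simp [D15, eT, h]
  · simp [D15, eT, h, this]

lemma S15_zero (n : ℕ) (hn : 4 ≤ n) (w : List (Fin 3))
    (h : (⟨0, by omega⟩ : Fin n) ∈ S15 n hn w) : S15 n hn w = {⟨0, by omega⟩} := by
  cases w with
  | nil => simp [S15, D15] at h
  | cons x w =>
    have hl := S15_last n hn w
    have hx : x = 0 ∨ x = 1 ∨ x = 2 := by fin_cases x <;> simp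
    rcases hx with rfl | rfl | rfl
    · rw [S15_cons] at h
      simp [D15, aT, hl] at h
    · rw [S15_cons] at h
      simp [D15, cT, hl] at h
    · rw [S15_e] at h
      ext q
      rw [S15_e]
      simp [h.2, Fin.ext_iff]

def A15 (n : ℕ) : Set (Fin n) := {q | 0 < q.val ∧ q.val < n - 1}

lemma S15_range (n : ℕ) (hn : 4 ≤ n) :
    Set.range (S15 n hn) = insert {⟨0, by omega⟩} (𝒫 (A15 n)) := by
  have key : ∀ (S : Set (Fin n)) (q : Fin n), q ∈ S → q ∈ A15 n →
      ∃ w, ∀ q ∈ A15 n, q ∈ S15 n hn w ↔ q ∈ S := by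
    classical
    intro S q hq hqA
    obtain ⟨w, hw⟩ := R15.all (hn := hn)
      (fun i => decide (∃ h : i + 1 < n, (⟨i + 1, h⟩ : Fin n) ∈ S)) (q.val - 1)
      (by simp only [A15, Set.mem_setOf_eq] at hqA; omega)
      (by
        simp only [A15, Set.mem_setOf_eq] at hqA
        have e : q.val - 1 + 1 = q.val := by omega
        simp only [e, decide_eq_true_eq]
        exact ⟨q.isLt, hq⟩)
    refine ⟨w, fun r hr => ?_⟩
    simp only [A15, Set.mem_setOf_eq] at hr
    have := hw (r.val - 1) (by omega)
    have e : r.val - 1 + 1 = r.val := by omega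
    simp only [e, decide_eq_true_eq] at this
    rw [← show (∃ h : r.val < n, (⟨r.val, h⟩ : Fin n) ∈ S) ↔ r ∈ S from
      ⟨fun ⟨_, h⟩ => h, fun h => ⟨r.isLt, h⟩⟩, this]
    rfl
  ext S
  constructor
  · rintro ⟨w, rfl⟩
    by_cases h : (⟨0, by omega⟩ : Fin n) ∈ S15 n hn w
    · left; exact S15_zero n hn w h
    · right
      intro q hq
      have hl := S15_last n hn w
      refine ⟨Nat.pos_of_ne_zero fun h0 => h ?_, ?_⟩
      · convert hq using 1; exact Fin.ext h0.symm
      · by_contra h1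
        apply hl
        convert hq using 1
        apply Fin.ext
        simp only
        omega
  · rintro (rfl | hS)
    · obtain ⟨w, hw⟩ := key Set.univ ⟨1, by omega⟩ trivial ⟨by simp, by simp only; omega⟩
      refine ⟨2 :: w, ?_⟩
      apply S15_zero
      rw [S15_e]
      exact ⟨rfl, (hw _ ⟨by simp, by simp only; omega⟩).2 trivial⟩
    · rcases S.eq_empty_or_nonempty with rfl | ⟨q, hq⟩
      · refine ⟨[2, 2], ?_⟩
        ext q
        simp [S15_e]
      · obtain ⟨w, hw⟩ := key S q hq (hS hq)
        have hq' := (hw q (hS hq)).2 hq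
        refine ⟨w, ?_⟩
        have h0 : (⟨0, by omega⟩ : Fin n) ∉ S15 n hn w := by
          intro h
          rw [S15_zero n hn w h] at hq'
          have := (hS hq).1
          rw [Set.mem_singleton_iff] at hq'
          rw [hq'] at this
          simp at this
        ext r
        by_cases hr : r ∈ A15 n
        · exact hw r hr
        · refine ⟨fun h => absurd h ?_, fun h => absurd (hS h) hr⟩
          simp only [A15, Set.mem_setOf_eq] at hr
          by_cases hr0 : r.val = 0
          · have : r = ⟨0, by omega⟩ := Fin.ext hr0
            rwa [this]
          · have : r = ⟨n - 1, by omega⟩ := Fin.ext (by simp only; omega)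
            rw [this]; exact S15_last n hn w

lemma A15_ncard (n : ℕ) (hn : 4 ≤ n) : (A15 n).ncard = n - 2 := by
  have : A15 n = ((Finset.Ioo (⟨0, by omega⟩ : Fin n) ⟨n - 1, by omega⟩ : Finset (Fin n)) :
      Set (Fin n)) := by
    ext q; simp [A15, Fin.lt_def]
  rw [this, Set.ncard_coe_finset, Fin.card_Ioo]
  simp only
  omega

lemma reach15 (n : ℕ) (hn : 4 ≤ n) (q : Fin n) :
    ∃ w, (D15 n hn).evalFrom (D15 n hn).start w = q := by
  obtain ⟨i, hi⟩ := q
  induction i with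
  | zero => exact ⟨[], rfl⟩
  | succ i ih =>
    by_cases h0 : i = 0
    · subst h0
      exact ⟨[2], by simp [D15, eT]⟩
    by_cases h1 : i + 1 = n - 1
    · exact ⟨[0], by simp [D15, aT, h1]⟩
    · obtain ⟨w, hw⟩ := ih (by omega)
      refine ⟨w ++ [0], ?_⟩
      rw [DFA.evalFrom_append_singleton, hw]
      simp [D15, aT, h0, show i ≠ n - 2 by omega, show i ≠ n - 1 by omega]

/-- For `n ≥ 4`, the reversal of `L_n(a,-,c,-,e)` meets the suffix-free bound
`2^{n−2} + 1`. -/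
theorem stmt15 (n : ℕ) (hn : 4 ≤ n) :
    quotComp (revLang (acceptsSet (D15 n hn))) = 2 ^ (n - 2) + 1 := by
  let T : Set (Fin n) → Set (List (Fin 3)) :=
    fun S => {x | (D15 n hn).evalFrom (D15 n hn).start x.reverse ∈ S}
  have hT : Function.Injective T := by
    intro S S' h
    ext q
    obtain ⟨w, rfl⟩ := reach15 n hn q
    have := Set.ext_iff.1 h w.reverse
    simpa [T] using this
  have hq : ∀ w, leftQuot w (revLang (acceptsSet (D15 n hn))) = T (S15 n hn w.reverse) := by
    intro w
    ext x
    simp [leftQuot, revLang, acceptsSet, T, S15, DFA.evalFrom_of_append]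
  have hset : {K | ∃ w, K = leftQuot w (revLang (acceptsSet (D15 n hn)))} =
      T '' Set.range (S15 n hn) := by
    ext K
    constructor
    · rintro ⟨w, rfl⟩
      exact ⟨_, ⟨w.reverse, rfl⟩, (hq w).symm⟩
    · rintro ⟨_, ⟨w, rfl⟩, rfl⟩
      exact ⟨w.reverse, by rw [hq, List.reverse_reverse]⟩
  unfold quotComp
  rw [hset, Set.ncard_image_of_injective _ hT, S15_range, Set.ncard_insert_of_notMem,
    Set.ncard_powerset, A15_ncard n hn]
  · intro h
    have := (h (Set.mem_singleton _)).1
    simp at this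
end

section
/- Let L be a suffix-free regular language with quotient complexity n ≥ 4, with distinct left quotients K_0 = L, K_1, …, K_{n−1} indexed so that K_{n−1} = ∅. Then: (i) L has at most 2^{n−2} + 1 atoms; indeed A_S can be an atom only if S = {0} or S ⊆ {1,…,n−2}; (ii) κ(A_∅) ≤ 2^{n−2} + 1; (iii) A_{{0}} = L, so κ(A_{{0}}) = n; (iv) for every nonempty S ⊆ {1,…,n−2}, κ(A_S) ≤ 1 + Σ_{x=1}^{|S|} Σ_{y=0}^{n−2−|S|} C(n−2, x)·C(n−2−x, y), where C(·,·) denotes a binomial coefficient. -/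
/-- The atomic intersection `A_S = (⋂_{i∈S} K_i) ∩ (⋂_{i∉S} K_iᶜ)` determined by the
family of quotients `Kq` and the subset `S`; an atom is a nonempty `A_S`. -/
def atomInt {α : Type} {n : ℕ} (Kq : Fin n → Set (List α)) (S : Set (Fin n)) :
    Set (List α) :=
  {w | ∀ i : Fin n, (i ∈ S → w ∈ Kq i) ∧ (i ∉ S → w ∉ Kq i)}

open Classical in
theorem count_aux {α : Type} {n : ℕ} (B : Finset (Fin n) → Finset (Fin n) → Set (List α))
    (T : Finset (Fin n)) (s m : ℕ) (C : Set (Set (List α)))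
    (h : ∀ K ∈ C, K = ∅ ∨ ∃ X Y, X ⊆ T ∧ Y ⊆ T \ X ∧ 1 ≤ X.card ∧ X.card ≤ s ∧ Y.card ≤ m ∧
      K = B X Y) :
    C.ncard ≤ 1 + ∑ x ∈ Finset.Icc 1 s, ∑ y ∈ Finset.Icc 0 m,
      Nat.choose T.card x * Nat.choose (T.card - x) y := by
  set F : Finset (Set (List α)) := (Finset.Icc 1 s).biUnion fun x => (Finset.Icc 0 m).biUnion fun y =>
    (T.powersetCard x).biUnion fun X => ((T \ X).powersetCard y).image (fun Y => B X Y) with hF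
  have hsub : C ⊆ ↑(insert ∅ F) := by
    intro K hK
    rcases h K hK with h0 | ⟨X, Y, h1, h2, h3, h4, h5, h6⟩
    · simp [h0]
    · simp only [Finset.coe_insert, Set.mem_insert_iff, Finset.mem_coe]
      right
      simp only [hF, Finset.mem_biUnion, Finset.mem_image, Finset.mem_powersetCard, Finset.mem_Icc]
      exact ⟨X.card, ⟨h3, h4⟩, Y.card, ⟨Nat.zero_le _, h5⟩, X, ⟨h1, rfl⟩, Y, ⟨h2, rfl⟩, h6.symm⟩
  have hFc : F.card ≤ ∑ x ∈ Finset.Icc 1 s, ∑ y ∈ Finset.Icc 0 m,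
      Nat.choose T.card x * Nat.choose (T.card - x) y := by
    refine Finset.card_biUnion_le.trans (Finset.sum_le_sum fun x _ => ?_)
    refine Finset.card_biUnion_le.trans (Finset.sum_le_sum fun y _ => ?_)
    refine Finset.card_biUnion_le.trans ?_
    rw [← Finset.card_powersetCard x T, ← smul_eq_mul, ← Finset.sum_const]
    refine Finset.sum_le_sum fun X hX => ?_
    rw [Finset.mem_powersetCard] at hX
    refine Finset.card_image_le.trans ?_
    rw [Finset.card_powersetCard, Finset.card_sdiff_of_subset hX.1, hX.2]
  calc C.ncard ≤ (↑(insert ∅ F) : Set (Set (List α))).ncard :=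
        Set.ncard_le_ncard hsub (Finset.finite_toSet _)
    _ = (insert ∅ F).card := Set.ncard_coe_finset _
    _ ≤ F.card + 1 := Finset.card_insert_le _ _
    _ ≤ _ := by omega

/-- Let `L` be a suffix-free regular language with `n ≥ 4` distinct left quotients
`K_0 = L, …, K_{n−1}` where `K_{n−1} = ∅`. Then: (i) `L` has at most `2^{n−2} + 1`
atoms, and `A_S` can be an atom only if `S = {0}` or `S ⊆ {1,…,n−2}`;
(ii) `κ(A_∅) ≤ 2^{n−2} + 1`; (iii) `A_{{0}} = L`, so `κ(A_{{0}}) = n`;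
(iv) for nonempty `S ⊆ {1,…,n−2}`,
`κ(A_S) ≤ 1 + Σ_{x=1}^{|S|} Σ_{y=0}^{n−2−|S|} C(n−2,x)·C(n−2−x,y)`. -/
theorem stmt16 {α : Type} (n : ℕ) (hn : 4 ≤ n) (L : Set (List α))
    (hreg : RegularLang L) (hsf : SuffixFree L)
    (Kq : Fin n → Set (List α)) (hinj : Function.Injective Kq)
    (hK0 : Kq ⟨0, by omega⟩ = L) (hKlast : Kq ⟨n - 1, by omega⟩ = ∅)
    (hquot : ∀ w : List α, ∃ i : Fin n, leftQuot w L = Kq i)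
    (hquot' : ∀ i : Fin n, ∃ w : List α, Kq i = leftQuot w L) :
    ({S : Set (Fin n) | atomInt Kq S ≠ ∅}.ncard ≤ 2 ^ (n - 2) + 1 ∧
      ∀ S : Set (Fin n), atomInt Kq S ≠ ∅ →
        S = {⟨0, by omega⟩} ∨ ∀ i ∈ S, 0 < i.val ∧ i.val < n - 1) ∧
    quotComp (atomInt Kq ∅) ≤ 2 ^ (n - 2) + 1 ∧
    (atomInt Kq {⟨0, by omega⟩} = L ∧ quotComp (atomInt Kq {⟨0, by omega⟩}) = n) ∧
    (∀ S : Set (Fin n), S ≠ ∅ → (∀ i ∈ S, 0 < i.val ∧ i.val < n - 1) →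
      quotComp (atomInt Kq S) ≤
        1 + ∑ x ∈ Finset.Icc 1 S.ncard, ∑ y ∈ Finset.Icc 0 (n - 2 - S.ncard),
          Nat.choose (n - 2) x * Nat.choose (n - 2 - x) y) := by
  classical
  set z : Fin n := ⟨0, by omega⟩ with hz
  set e : Fin n := ⟨n - 1, by omega⟩ with he
  have hze : z ≠ e := by
    intro h
    have := congrArg Fin.val h
    simp [hz, he] at this
    omega
  have hmid : ∀ i : Fin n, (0 < i.val ∧ i.val < n - 1) ↔ (i ≠ z ∧ i ≠ e) := by
    intro i
    have := i.2
    simp only [hz, he, ne_eq, Fin.ext_iff]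
    omega
  simp only [hmid]
  have hemp : ∀ x, x ∉ Kq e := by intro x; rw [hKlast]; exact id
  have hne : ∀ i, i ≠ e → ∃ x, x ∈ Kq i := by
    intro i hi
    by_contra! h
    exact hi (hinj (by rw [hKlast]; exact Set.eq_empty_of_forall_notMem h))
  have hdis : ∀ i, i ≠ z → ∀ x, x ∈ Kq i → x ∉ Kq z := by
    intro i hi x hx hxz
    obtain ⟨w, hw⟩ := hquot' i
    rw [hw] at hx
    rw [hK0] at hxz
    have h0 := hsf w x hxz hx
    subst h0
    exact hi (hinj (by rw [hw, hK0]; rfl))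
  have hd : ∀ (w : List α) (i : Fin n), ∃ j, ∀ x, x ∈ Kq j ↔ w ++ x ∈ Kq i := by
    intro w i
    obtain ⟨u, hu⟩ := hquot' i
    obtain ⟨j, hj⟩ := hquot (u ++ w)
    refine ⟨j, fun x => ?_⟩
    rw [← hj, hu]
    simp [leftQuot]
  choose d hd using hd
  have hde : ∀ w, d w e = e := by
    intro w
    by_contra h
    obtain ⟨x, hx⟩ := hne _ h
    exact hemp _ ((hd w e x).1 hx)
  have hdz : ∀ w, w ≠ [] → ∀ i, d w i ≠ z := by
    intro w hw i h
    obtain ⟨x, hx⟩ := hne z hze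
    have h1 := hx
    rw [← h, hd] at h1
    obtain ⟨u, hu⟩ := hquot' i
    rw [hu] at h1
    rw [hK0] at hx
    have := hsf (u ++ w) x hx (by simpa [leftQuot] using h1)
    simp at this
    exact hw this.2
  have hdrop : ∀ w, w ≠ [] → ∃ q, q ≠ e ∧ d w q = e := by
    intro w hw
    by_contra! hcon
    have hit : ∀ k, (d w)^[k] z ≠ e := by
      intro k
      induction k with
      | zero => simpa using hze
      | succ k ih => rw [Function.iterate_succ_apply']; exact hcon _ ih
    have hmem : ∀ k x, x ∈ Kq ((d w)^[k] z) ↔ (List.replicate k w).flatten ++ x ∈ L := by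
      intro k
      induction k with
      | zero => intro x; simp [hK0]
      | succ k ih =>
        intro x
        rw [Function.iterate_succ_apply', hd, ih, List.replicate_succ']
        simp
    obtain ⟨a, b, hab, hEq⟩ := Finite.exists_ne_map_eq_of_infinite (fun k : ℕ => (d w)^[k] z)
    wlog hlt : a < b generalizing a b
    · exact this b a hab.symm hEq.symm (by omega)
    obtain ⟨c, rfl⟩ := Nat.exists_eq_add_of_lt hlt
    obtain ⟨x, hx⟩ := hne _ (hit a)
    have h1 := (hmem _ _).1 hx
    rw [hEq] at hx
    have h2 := (hmem _ _).1 hx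
    have h3 : a + c + 1 = (c + 1) + a := by omega
    rw [h3, List.replicate_add, List.flatten_append, List.append_assoc] at h2
    have := hsf _ _ h1 h2
    simp [List.replicate_succ, hw] at this
  set T : Finset (Fin n) := (Finset.univ.erase z).erase e with hT
  have hTc : T.card = n - 2 := by
    rw [hT, Finset.card_erase_of_mem (by simp [hze.symm]), Finset.card_erase_of_mem (by simp)]
    simp
    omega
  have hTm : ∀ i, i ∈ T ↔ i ≠ z ∧ i ≠ e := by
    intro i; simp [hT, and_comm]
  have hi2 : ∀ S : Set (Fin n), atomInt Kq S ≠ ∅ → S = {z} ∨ ∀ i ∈ S, i ≠ z ∧ i ≠ e := by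
    intro S hS
    obtain ⟨x, hx⟩ := Set.nonempty_iff_ne_empty.2 hS
    have heS : e ∉ S := fun h => hemp x ((hx e).1 h)
    by_cases h0 : z ∈ S
    · left
      ext i
      constructor
      · intro hi
        by_contra hiz
        exact hdis i hiz x ((hx i).1 hi) ((hx z).1 h0)
      · rintro rfl; exact h0
    · right
      intro i hi
      exact ⟨fun h => h0 (h ▸ hi), fun h => heS (h ▸ hi)⟩
  have hL : atomInt Kq {z} = L := by
    ext x
    constructor
    · intro hx
      rw [← hK0]; exact (hx z).1 rfl
    · intro hx i
      rw [← hK0] at hx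
      refine ⟨?_, fun hi hxi => hdis i hi x hxi hx⟩
      rintro rfl; exact hx
  refine ⟨⟨?_, hi2⟩, ?_, ⟨hL, ?_⟩, ?_⟩
  · have hsub : {S : Set (Fin n) | atomInt Kq S ≠ ∅} ⊆
        ↑(insert {z} (T.powerset.image (fun X : Finset (Fin n) => (X : Set (Fin n))))) := by
      intro S hS
      rcases hi2 S hS with h | h
      · simp [h]
      · simp only [Finset.coe_insert, Set.mem_insert_iff, Finset.mem_coe, Finset.mem_image,
          Finset.mem_powerset]
        right
        refine ⟨S.toFinset, ?_, by simp⟩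
        intro i hi
        rw [hTm]
        exact h i (by simpa using hi)
    refine (Set.ncard_le_ncard hsub (Finset.finite_toSet _)).trans ?_
    rw [Set.ncard_coe_finset]
    refine (Finset.card_insert_le _ _).trans ?_
    have := (Finset.card_image_le (s := T.powerset) (f := fun X : Finset (Fin n) => (X : Set (Fin n))))
    rw [Finset.card_powerset, hTc] at this
    omega
  · have hsub : {K : Set (List α) | ∃ w : List α, K = leftQuot w (atomInt Kq ∅)} ⊆
        ↑(insert (atomInt Kq ∅) (T.powerset.image
          (fun X : Finset (Fin n) => {x : List α | ∀ i ∈ X, x ∉ Kq i}))) := by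
      rintro K ⟨w, rfl⟩
      simp only [Finset.coe_insert, Set.mem_insert_iff, Finset.mem_coe, Finset.mem_image,
          Finset.mem_powerset]
      by_cases hw : w = []
      · left; subst hw; rfl
      · right
        refine ⟨(Finset.univ.image (d w)).erase e, ?_, ?_⟩
        · intro i hi
          simp only [Finset.mem_erase, Finset.mem_image, Finset.mem_univ, true_and] at hi
          obtain ⟨h1, j, rfl⟩ := hi
          exact (hTm _).2 ⟨hdz w hw j, h1⟩
        · ext x
          simp only [Finset.mem_erase, Finset.mem_image, Finset.mem_univ, true_and,
            Set.mem_setOf_eq, leftQuot, atomInt, Set.mem_empty_iff_false, false_imp_iff,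
            not_false_eq_true, true_imp_iff]
          constructor
          · intro h i
            rw [← hd]
            by_cases hi : d w i = e
            · rw [hi]; exact hemp x
            · exact h _ ⟨hi, i, rfl⟩
          · rintro h _ ⟨_, i, rfl⟩
            rw [hd]; exact h i
    refine (Set.ncard_le_ncard hsub (Finset.finite_toSet _)).trans ?_
    rw [Set.ncard_coe_finset]
    refine (Finset.card_insert_le _ _).trans ?_
    have := (Finset.card_image_le (s := T.powerset)
      (f := fun X : Finset (Fin n) => {x : List α | ∀ i ∈ X, x ∉ Kq i}))
    rw [Finset.card_powerset, hTc] at this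
    omega
  · rw [hL, quotComp]
    have : {K : Set (List α) | ∃ w : List α, K = leftQuot w L} = Set.range Kq := by
      ext K
      constructor
      · rintro ⟨w, rfl⟩
        obtain ⟨i, hi⟩ := hquot w
        exact ⟨i, hi.symm⟩
      · rintro ⟨i, rfl⟩
        exact hquot' i
    rw [this, ← Set.image_univ, Set.ncard_image_of_injective _ hinj]
    simp
  · intro S hS hSm
    rw [← hTc]
    refine count_aux (fun X Y => {x | (∀ i ∈ X, x ∈ Kq i) ∧ ∀ i ∈ Y, x ∉ Kq i}) T _ _ _ ?_
    rintro K ⟨w, rfl⟩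
    obtain ⟨s, hs⟩ := Set.nonempty_iff_ne_empty.2 hS
    have hSc : S.toFinset.card = S.ncard := (Set.ncard_eq_toFinset_card' S).symm
    have hST : S.toFinset ⊆ T := fun i hi => (hTm i).2 (hSm i (by simpa using hi))
    by_cases hw : w = []
    · right
      subst hw
      refine ⟨S.toFinset, T \ S.toFinset, hST, subset_rfl, ?_, hSc.le, ?_, ?_⟩
      · exact Finset.card_pos.2 ⟨s, by simpa using hs⟩
      · rw [Finset.card_sdiff_of_subset hST, hSc]
      · ext x
        simp only [leftQuot, atomInt, List.nil_append, Set.mem_setOf_eq, Set.mem_toFinset,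
          Finset.mem_sdiff, hTm]
        constructor
        · intro h
          exact ⟨fun i hi => (h i).1 hi, fun i hi => (h i).2 hi.2⟩
        · rintro ⟨h1, h2⟩ i
          refine ⟨h1 i, fun hi => ?_⟩
          by_cases hiz : i = z
          · rw [hiz]; exact hdis s (hSm s hs).1 x (h1 s hs)
          by_cases hie : i = e
          · rw [hie]; exact hemp x
          exact h2 i ⟨⟨hiz, hie⟩, hi⟩
    · by_cases hE : leftQuot w (atomInt Kq S) = ∅
      · left; exact hE
      right
      obtain ⟨y, hy⟩ := Set.nonempty_iff_ne_empty.2 hE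
      have hy1 : ∀ i, i ∈ S → y ∈ Kq (d w i) := fun i hi => (hd w i y).2 ((hy i).1 hi)
      have hy2 : ∀ i, i ∉ S → y ∉ Kq (d w i) := fun i hi h => (hy i).2 hi ((hd w i y).1 h)
      obtain ⟨q, hqe, hq⟩ := hdrop w hw
      have hqS : q ∉ S := fun h => hemp y (hq ▸ hy1 q h)
      have heS : e ∉ S := fun h => (hSm e h).2 rfl
      refine ⟨S.toFinset.image (d w),
        (((Finset.univ \ S.toFinset).erase q).erase e).image (d w) |>.erase e, ?_, ?_, ?_, ?_, ?_, ?_⟩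
      · intro i hi
        simp only [Finset.mem_image, Set.mem_toFinset] at hi
        obtain ⟨j, hj, rfl⟩ := hi
        exact (hTm _).2 ⟨hdz w hw j, fun h => hemp y (h ▸ hy1 j hj)⟩
      · intro i hi
        simp only [Finset.mem_image, Finset.mem_erase, Finset.mem_sdiff, Finset.mem_univ,
          true_and, Set.mem_toFinset] at hi
        obtain ⟨h1, j, ⟨_, _, hj⟩, rfl⟩ := hi
        rw [Finset.mem_sdiff]
        refine ⟨(hTm _).2 ⟨hdz w hw j, h1⟩, fun hm => ?_⟩
        simp only [Finset.mem_image, Set.mem_toFinset] at hm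
        obtain ⟨k, hk, hkj⟩ := hm
        exact hy2 j hj (hkj ▸ hy1 k hk)
      · exact Finset.card_pos.2 ⟨d w s, Finset.mem_image_of_mem _ (by simpa using hs)⟩
      · exact Finset.card_image_le.trans hSc.le
      · refine (Finset.card_le_card (Finset.erase_subset _ _)).trans
          (Finset.card_image_le.trans ?_)
        rw [Finset.card_erase_of_mem (by simp [hqe.symm, heS]),
          Finset.card_erase_of_mem (by simp [hqS]),
          Finset.card_sdiff_of_subset (Finset.subset_univ _), hSc, hTc]
        simp
        omega
      · ext x
        simp only [leftQuot, atomInt, Set.mem_setOf_eq, Finset.mem_image, Finset.mem_erase,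
          Finset.mem_sdiff, Finset.mem_univ, true_and, Set.mem_toFinset, ← hd]
        constructor
        · intro h
          constructor
          · rintro _ ⟨i, hi, rfl⟩
            exact (h i).1 hi
          · rintro _ ⟨_, i, ⟨_, _, hi⟩, rfl⟩
            exact (h i).2 hi
        · rintro ⟨h1, h2⟩ i
          refine ⟨fun hi => h1 _ ⟨i, hi, rfl⟩, fun hi => ?_⟩
          by_cases hie : d w i = e
          · rw [hie]; exact hemp x
          refine h2 _ ⟨hie, i, ⟨?_, ?_, hi⟩, rfl⟩
          · rintro rfl; exact hie (hde w)
          · rintro rfl; exact hie hq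
end

section
/- For n ≥ 4, let L be the language of the DFA D_n(a,b,c,d,e), with distinct left quotients K_0 = L, …, K_{n−1} indexed so that K_q is the language of state q (so K_{n−1} = ∅). Then L meets the bounds for atoms: A_∅ is an atom with κ(A_∅) = 2^{n−2} + 1; A_{{0}} is an atom with κ(A_{{0}}) = n; and for every nonempty S ⊆ {1,…,n−2}, A_S is an atom with κ(A_S) = 1 + Σ_{x=1}^{|S|} Σ_{y=0}^{n−2−|S|} C(n−2, x)·C(n−2−x, y). In particular L has exactly 2^{n−2} + 1 atoms. -/
/-- The DFA `D_n(a,b,c,d,e)` of Definition 4.1, with alphabet `{a,b,c,d,e}`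
encoded as `Fin 5` (`a = 0`, `b = 1`, `c = 2`, `d = 3`, `e = 4`), initial state `0`,
and final states the odd states strictly between `0` and `n-1`. -/
def D6 (n : ℕ) (hn : 4 ≤ n) : DFA (Fin 5) (Fin n) where
  step := fun q x =>
    if x = 0 then aT n hn q
    else if x = 1 then bT n hn q
    else if x = 2 then cT n hn q
    else if x = 3 then dT n hn q
    else eT n hn q
  start := ⟨0, by omega⟩
  accept := {q : Fin n | 0 < q.val ∧ q.val < n - 1 ∧ q.val % 2 = 1}
section helpers

variable {n : ℕ} {hn : 4 ≤ n}

theorem ev_nil (q : Fin n) : (D6 n hn).evalFrom q [] = q := rfl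

theorem ev_cons (q : Fin n) (x : Fin 5) (w : List (Fin 5)) :
    (D6 n hn).evalFrom q (x :: w) = (D6 n hn).evalFrom ((D6 n hn).step q x) w := rfl

theorem ev_app (q : Fin n) (v w : List (Fin 5)) :
    (D6 n hn).evalFrom q (v ++ w) = (D6 n hn).evalFrom ((D6 n hn).evalFrom q v) w :=
  DFA.evalFrom_of_append _ _ _ _

theorem step_ne (q : Fin n) (x : Fin 5) (hq : q.val ≠ 0) : ((D6 n hn).step q x).val ≠ 0 := by
  have := q.isLt
  simp only [D6, aT, bT, cT, dT, eT]
  split_ifs <;> simp <;> omega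

theorem ev_ne (w : List (Fin 5)) : ∀ (q : Fin n), q.val ≠ 0 →
    ((D6 n hn).evalFrom q w).val ≠ 0 := by
  induction w with
  | nil => intro q h; exact h
  | cons x w ih => intro q h; rw [ev_cons]; exact ih _ (step_ne q x h)

theorem step_sink (q : Fin n) (x : Fin 5) (hq : q.val = n - 1) : (D6 n hn).step q x = q := by
  have := q.isLt
  apply Fin.ext
  simp only [D6, aT, bT, cT, dT, eT]
  split_ifs <;> simp <;> omega

theorem ev_sink (w : List (Fin 5)) : ∀ (q : Fin n), q.val = n - 1 →
    (D6 n hn).evalFrom q w = q := by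
  induction w with
  | nil => intro q h; rfl
  | cons x w ih => intro q h; rw [ev_cons, step_sink q x h]; exact ih _ h

theorem acc_iff (q : Fin n) : q ∈ (D6 n hn).accept ↔ 0 < q.val ∧ q.val < n - 1 ∧ q.val % 2 = 1 :=
  Iff.rfl

theorem sink_not (q : Fin n) (w : List (Fin 5)) (hq : q.val = n - 1) :
    (D6 n hn).evalFrom q w ∉ (D6 n hn).accept := by
  rw [ev_sink w q hq, acc_iff]; omega

theorem step_zero (q : Fin n) (x : Fin 5) (hq : q.val = 0) (hx : x ≠ 4) :
    ((D6 n hn).step q x).val = n - 1 := by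
  have : x = 0 ∨ x = 1 ∨ x = 2 ∨ x = 3 := by revert x; decide
  rcases this with rfl | rfl | rfl | rfl <;> simp [D6, aT, bT, cT, dT, hq]

theorem step_e (q : Fin n) (hq : q.val ≠ 0) : ((D6 n hn).step q 4).val = n - 1 := by
  simp [D6, eT, hq]

theorem step_e0 (q : Fin n) (hq : q.val = 0) : ((D6 n hn).step q 4).val = 1 := by
  simp [D6, eT, hq]

theorem zero_excl (p q : Fin n) (x : List (Fin 5)) (hp : p.val ≠ 0) (hq : q.val = 0)
    (h : (D6 n hn).evalFrom p x ∈ (D6 n hn).accept) :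
    (D6 n hn).evalFrom q x ∉ (D6 n hn).accept := by
  cases x with
  | nil => rw [ev_nil, acc_iff]; omega
  | cons y x =>
    rw [ev_cons] at h ⊢
    by_cases hy : y = 4
    · subst hy
      exact absurd h (sink_not _ _ (step_e p hp))
    · exact sink_not _ _ (step_zero q y hq hy)

def Rl (n : ℕ) (hn : 4 ≤ n) (f : Fin n → Fin n) : Prop :=
  ∃ w, ∀ q : Fin n, q.val ≠ 0 → (D6 n hn).evalFrom q w = f q

theorem Rl.comp {f g : Fin n → Fin n} (hf : Rl n hn f) (hg : Rl n hn g) :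
    Rl n hn (fun q => g (f q)) := by
  obtain ⟨v, hv⟩ := hf
  obtain ⟨w, hw⟩ := hg
  refine ⟨v ++ w, fun q hq => ?_⟩
  rw [ev_app, hw _ (ev_ne v q hq), hv q hq]

theorem Rl.congr {f g : Fin n → Fin n} (hf : Rl n hn f) (h : ∀ q, q.val ≠ 0 → f q = g q) :
    Rl n hn g := by
  obtain ⟨v, hv⟩ := hf
  exact ⟨v, fun q hq => (hv q hq).trans (h q hq)⟩

theorem Rl.id : Rl n hn (fun q => q) := ⟨[], fun _ _ => rfl⟩

theorem Rl.mul {s t : Equiv.Perm (Fin n)} (hs : Rl n hn s) (ht : Rl n hn t) :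
    Rl n hn (s * t : Equiv.Perm (Fin n)) := ht.comp hs

theorem Rl.inv {s : Equiv.Perm (Fin n)} (hs : Rl n hn s) :
    Rl n hn (s⁻¹ : Equiv.Perm (Fin n)) := by
  have hk : ∀ k : ℕ, Rl n hn (s ^ k : Equiv.Perm (Fin n)) := by
    intro k
    induction k with
    | zero => exact Rl.id
    | succ k ih => rw [pow_succ]; exact ih.mul hs
  have : s⁻¹ = s ^ (orderOf s - 1) := by
    rw [inv_eq_iff_mul_eq_one, ← pow_succ', Nat.sub_add_cancel (orderOf_pos s), pow_orderOf_eq_one]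
  rw [this]; exact hk _

theorem swap_one_two : Rl n hn (Equiv.swap (⟨1, by omega⟩ : Fin n) ⟨2, by omega⟩) := by
  refine ⟨[1], fun q hq => ?_⟩
  rw [ev_cons, ev_nil]
  apply Fin.ext
  simp only [D6, bT, Equiv.swap_apply_def, Fin.ext_iff]
  simp only [hq]
  split_ifs <;> simp_all

theorem exists_cyc : ∃ s : Equiv.Perm (Fin n), Rl n hn s ∧
    ∀ (i : ℕ) (h : i + 1 < n - 1), 1 ≤ i → s ⟨i, by omega⟩ = ⟨i + 1, by omega⟩ := by
  have hinj : Function.Injective (fun q : Fin n => if q.val = 0 then q else aT n hn q) := by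
    intro p q h
    have := p.isLt
    have := q.isLt
    apply Fin.ext
    simp only [aT] at h
    split_ifs at h <;> simp only [Fin.ext_iff] at h <;> omega
  refine ⟨Equiv.ofBijective _ (Finite.injective_iff_bijective.mp hinj), ⟨[0], fun q hq => ?_⟩, ?_⟩
  · rw [ev_cons, ev_nil]
    simp [D6, hq]
  · intro i h h1
    apply Fin.ext
    simp only [Equiv.ofBijective_apply, aT]
    split_ifs <;> simp at * <;> omega

theorem swap_adj (i : ℕ) (h1 : 1 ≤ i) : ∀ h : i + 1 < n - 1,
    Rl n hn (Equiv.swap (⟨i, by omega⟩ : Fin n) ⟨i + 1, by omega⟩) := by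
  induction i, h1 using Nat.le_induction with
  | base => intro h; exact swap_one_two
  | succ i h1 ih =>
    intro h
    obtain ⟨s, hs, hs'⟩ := exists_cyc (n := n) (hn := hn)
    have e1 := hs' i (by omega) h1
    have e2 := hs' (i + 1) (by omega) (by omega)
    rw [← e1, ← e2, Equiv.swap_apply_apply]
    exact (hs.mul (ih (by omega))).mul hs.inv

theorem swap_lt (i j : ℕ) (h1 : 1 ≤ i) (hij : i + 1 ≤ j) : ∀ h : j < n - 1,
    Rl n hn (Equiv.swap (⟨i, by omega⟩ : Fin n) ⟨j, by omega⟩) := by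
  induction j, hij using Nat.le_induction with
  | base => intro h; exact swap_adj i h1 h
  | succ j hj ih =>
    intro h
    have h2 := swap_adj (hn := hn) j (by omega) h
    have h3 := (h2.mul (ih (by omega))).mul h2.inv
    rw [← Equiv.swap_apply_apply] at h3
    rw [Equiv.swap_apply_left, Equiv.swap_apply_of_ne_of_ne] at h3
    · exact h3
    · simp [Fin.ext_iff]; omega
    · simp [Fin.ext_iff]; omega

theorem swap_all (p q : Fin n) (hp : p.val ≠ 0) (hp' : p.val ≠ n - 1) (hq : q.val ≠ 0)
    (hq' : q.val ≠ n - 1) : Rl n hn (Equiv.swap p q) := by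
  have := p.isLt
  have := q.isLt
  rcases lt_trichotomy p.val q.val with h | h | h
  · exact swap_lt (hn := hn) p.val q.val (by omega) h (by omega)
  · rw [Fin.ext h, Equiv.swap_self]; exact Rl.id
  · rw [Equiv.swap_comm]; exact swap_lt (hn := hn) q.val p.val (by omega) h (by omega)

theorem conj_rl {s : Equiv.Perm (Fin n)} {f : Fin n → Fin n} (hs : Rl n hn s) (hf : Rl n hn f) :
    Rl n hn (fun q => s⁻¹ (f (s q))) := (hs.comp hf).comp hs.inv

theorem to_sink (p z : Fin n) (hp : p.val ≠ 0) (hz : z.val = n - 1) :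
    Rl n hn (fun q => if q = p then z else q) := by
  by_cases hp' : p.val = n - 1
  · refine Rl.id.congr fun q _ => ?_
    split_ifs with h
    · apply Fin.ext; rw [h]; omega
    · rfl
  have hd : Rl n hn (fun q => if q.val = 1 then z else q) := by
    refine ⟨[3], fun q hq => ?_⟩
    rw [ev_cons, ev_nil]
    apply Fin.ext
    simp only [D6, dT]
    simp
    split_ifs <;> (try simp) <;> omega
  have hs := swap_all (hn := hn) p ⟨1, by omega⟩ hp hp' (by simp) (by simp; omega)
  refine (conj_rl hs hd).congr fun q hq => ?_
  rw [Equiv.swap_inv]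
  by_cases h : q = p
  · subst h
    simp only [Equiv.swap_apply_left, if_true]
    apply Equiv.swap_apply_of_ne_of_ne
    · intro h; subst h; omega
    · intro h; rw [h] at hz; simp at hz; omega
  · rw [if_neg h, if_neg, Equiv.swap_apply_self]
    intro h2
    have h2 : Equiv.swap p ⟨1, by omega⟩ q = ⟨1, by omega⟩ := Fin.ext h2
    rw [Equiv.swap_apply_eq_iff, Equiv.swap_apply_right] at h2
    exact h h2

theorem to_mid (p z : Fin n) (hp : p.val ≠ 0) (hp' : p.val ≠ n - 1) (hz : z.val ≠ 0)
    (hz' : z.val ≠ n - 1) :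
    Rl n hn (fun q => if q = p then z else q) := by
  by_cases hpz : z = p
  · refine Rl.id.congr fun q _ => ?_
    split_ifs with h
    · rw [h, hpz]
    · rfl
  let o : Fin n := ⟨1, by omega⟩
  let m : Fin n := ⟨n - 2, by omega⟩
  have ho : o.val = 1 := rfl
  have hm : m.val = n - 2 := rfl
  have hom : m ≠ o := by intro h; rw [Fin.ext_iff] at h; omega
  have hc : Rl n hn (fun q => if q = m then o else q) := by
    refine ⟨[2], fun q hq => ?_⟩
    rw [ev_cons, ev_nil]
    apply Fin.ext
    have h1 : (D6 n hn).step q 2 = cT n hn q := by simp [D6]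
    have h2 : q = m ↔ q.val = n - 2 := Fin.ext_iff
    simp only [h1, cT, hq, h2, o, if_false]
  have hs1 := swap_all (hn := hn) p m hp hp' (by omega) (by omega)
  let z' := Equiv.swap p m z
  have hzm : z' ≠ m := by
    intro h
    have h : Equiv.swap p m z = m := h
    rw [Equiv.swap_apply_eq_iff, Equiv.swap_apply_right] at h
    exact hpz h
  have hz1 : z'.val ≠ 0 ∧ z'.val ≠ n - 1 := by
    simp only [z', Equiv.swap_apply_def]
    split_ifs <;> omega
  have hs2 := swap_all (hn := hn) z' o hz1.1 hz1.2 (by omega) (by omega)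
  have hs := hs2.mul hs1
  have e1 : (Equiv.swap z' o * Equiv.swap p m) p = m := by
    rw [Equiv.Perm.mul_apply, Equiv.swap_apply_left, Equiv.swap_apply_of_ne_of_ne hzm.symm hom]
  have e2 : (Equiv.swap z' o * Equiv.swap p m) z = o := by
    rw [Equiv.Perm.mul_apply]; exact Equiv.swap_apply_left _ _
  refine (conj_rl hs hc).congr fun q hq => ?_
  by_cases h : q = p
  · rw [if_pos h, h, if_pos e1, Equiv.Perm.inv_eq_iff_eq, e2]
  · rw [if_neg h, if_neg, Equiv.Perm.inv_eq_iff_eq]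
    exact fun h' => h (Equiv.injective _ (h'.trans e1.symm))

theorem to_any (p z : Fin n) (hp : p.val ≠ 0) (hp' : p.val ≠ n - 1) (hz : z.val ≠ 0) :
    Rl n hn (fun q => if q = p then z else q) := by
  by_cases h : z.val = n - 1
  · exact to_sink p z hp h
  · exact to_mid p z hp hp' hz h

theorem rl_all_aux (k : ℕ) : ∀ f : Fin n → Fin n, (∀ q, q.val = 0 → f q = q) →
    (∀ q, q.val = n - 1 → f q = q) → (∀ q, q.val ≠ 0 → (f q).val ≠ 0) →
    (Finset.univ.filter fun q => f q ≠ q).card = k → Rl n hn f := by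
  induction k using Nat.strong_induction_on with
  | _ k ih =>
  intro f h0 hz hne hk
  by_cases hfix : ∀ p, f p = p
  · exact Rl.id.congr fun q _ => (hfix q).symm
  push Not at hfix
  by_cases hs : Function.Surjective f
  · obtain ⟨p, hp⟩ := hfix
    have hinj : Function.Injective f := Finite.injective_iff_surjective.mpr hs
    have hp0 : p.val ≠ 0 := fun h => hp (h0 p h)
    have hpz : p.val ≠ n - 1 := fun h => hp (hz p h)
    have hf0 := hne p hp0
    have hfz : (f p).val ≠ n - 1 := fun h => hp (hinj (hz _ h))
    have key : ∀ q, f q = q → Equiv.swap p (f p) (f q) = q := by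
      intro q hq
      rw [hq]
      apply Equiv.swap_apply_of_ne_of_ne
      · rintro rfl; exact hp hq
      · rintro rfl; exact hp (hinj hq)
    have hg : Rl n hn (fun q => Equiv.swap p (f p) (f q)) := by
      refine ih _ ?_ _ (fun q h => key q (h0 q h)) (fun q h => key q (hz q h)) ?_ rfl
      · rw [← hk]
        apply Finset.card_lt_card
        rw [Finset.ssubset_iff_of_subset]
        · exact ⟨p, by simpa using hp, by simp⟩
        · intro q hq
          simp only [Finset.mem_filter, Finset.mem_univ, true_and] at hq ⊢
          exact fun h => hq (key q h)
      · intro q hq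
        have := hne q hq
        rw [Equiv.swap_apply_def]
        split_ifs <;> omega
    refine (hg.comp (swap_all p (f p) hp0 hpz hf0 hfz)).congr fun q _ => ?_
    rw [Equiv.swap_apply_self]
  · rw [Function.Surjective] at hs
    push Not at hs
    obtain ⟨p, hp⟩ := hs
    have hp0 : p.val ≠ 0 := fun h => hp p (h0 p h)
    have hpz : p.val ≠ n - 1 := fun h => hp p (hz p h)
    have hg : Rl n hn (fun q => if q = p then p else f q) := by
      refine ih _ ?_ _ ?_ ?_ ?_ rfl
      · rw [← hk]
        apply Finset.card_lt_card
        rw [Finset.ssubset_iff_of_subset]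
        · exact ⟨p, by simpa using hp p, by simp⟩
        · intro q hq
          simp only [Finset.mem_filter, Finset.mem_univ, true_and] at hq ⊢
          intro h
          apply hq
          split_ifs with h2
          · exact h2.symm
          · exact h
      · intro q hq
        split_ifs with h2
        · exact h2.symm
        · exact h0 q hq
      · intro q hq
        split_ifs with h2
        · exact h2.symm
        · exact hz q hq
      · intro q hq
        split_ifs
        · exact hp0
        · exact hne q hq
    refine (hg.comp (to_any p (f p) hp0 hpz (hne p hp0))).congr fun q _ => ?_
    by_cases h : q = p
    · simp [h]
    · simp [h, hp q]

/-- Every map of the nonzero states fixing the sink is induced by a word. -/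
theorem rl_all (f : Fin n → Fin n) 
    (hz : ∀ q, q.val = n - 1 → f q = q) (hne : ∀ q, q.val ≠ 0 → (f q).val ≠ 0) : Rl n hn f := by
  refine (rl_all_aux (hn := hn) _ (fun q => if q.val = 0 then q else f q) ?_ ?_ ?_ rfl).congr ?_
  · intro q hq; simp [hq]
  · intro q hq
    have : q.val ≠ 0 := by omega
    simp [this, hz q hq]
  · intro q hq; simp [hq, hne q hq]
  · intro q hq; simp [hq]

end helpers

section counting

variable {n : ℕ}

def Md (n : ℕ) : Finset (Fin n) := Finset.univ.filter fun i => 0 < i.val ∧ i.val < n - 1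

theorem mem_Md (q : Fin n) : q ∈ Md n ↔ 0 < q.val ∧ q.val < n - 1 := by simp [Md]

theorem card_Md (hn : 4 ≤ n) : (Md n).card = n - 2 := by
  have : Md n = Finset.Ioo (⟨0, by omega⟩ : Fin n) ⟨n - 1, by omega⟩ := by
    ext q; simp [mem_Md, Fin.lt_def]
  rw [this, Fin.card_Ioo]
  simp only
  omega

theorem sep (hn : 4 ≤ n) (U : Finset (Fin n)) (hU : U ⊆ Md n) : ∃ w, ∀ q : Fin n, q.val ≠ 0 →
    ((D6 n hn).evalFrom q w ∈ (D6 n hn).accept ↔ q ∈ U) := by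
  obtain ⟨w, hw⟩ := rl_all (hn := hn)
    (fun q => if q ∈ U then ⟨1, by omega⟩ else ⟨n - 1, by omega⟩) (by
      intro q hq
      have : q ∉ U := fun h => by have := (mem_Md q).1 (hU h); omega
      simp only [this, if_false]
      exact Fin.ext hq.symm) (by
      intro q hq
      split_ifs <;> simp; omega)
  refine ⟨w, fun q hq => ?_⟩
  rw [hw q hq, acc_iff]
  dsimp only
  split_ifs with h
  · simp [h]; omega
  · simp [h]

theorem sep' (hn : 4 ≤ n) (U : Finset (Fin n)) (hU : U ⊆ Md n) :
    ∃ w, w ∈ atomInt (stateLang (D6 n hn)) (U : Set (Fin n)) := by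
  obtain ⟨w, hw⟩ := sep hn U hU
  refine ⟨1 :: 1 :: w, fun i => ?_⟩
  have key : (D6 n hn).evalFrom i (1 :: 1 :: w) ∈ (D6 n hn).accept ↔ i ∈ U := by
    by_cases hi : i.val = 0
    · constructor
      · intro h
        exact absurd h (by rw [ev_cons]; exact sink_not _ _ (step_zero i 1 hi (by decide)))
      · intro h; have := (mem_Md i).1 (hU h); omega
    · have : (D6 n hn).step ((D6 n hn).step i 1) 1 = i := by
        apply Fin.ext
        simp only [D6, bT]
        simp
        split_ifs <;> simp at * <;> omega
      rw [ev_cons, ev_cons, this, hw i hi]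
  constructor
  · intro h; exact key.2 h
  · intro h h2; exact h (key.1 h2)

theorem exists_word (hn : 4 ≤ n) (f : Fin n → Fin n)
    (hz : ∀ q, q.val = n - 1 → f q = q) (hne : ∀ q, q.val ≠ 0 → (f q).val ≠ 0) :
    ∃ w, (∀ q : Fin n, q.val ≠ 0 → (D6 n hn).evalFrom q w = f q) ∧
      ∀ q : Fin n, q.val = 0 → ((D6 n hn).evalFrom q w).val = n - 1 := by
  obtain ⟨w, hw⟩ := rl_all (hn := hn) f hz hne
  refine ⟨1 :: 1 :: w, fun q hi => ?_, fun q hi => ?_⟩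
  · have : (D6 n hn).step ((D6 n hn).step q 1) 1 = q := by
      apply Fin.ext
      simp only [D6, bT]
      simp
      split_ifs <;> simp at * <;> omega
    rw [ev_cons, ev_cons, this, hw q hi]
  · rw [ev_cons, ev_sink _ _ (step_zero q 1 hi (by decide))]
    exact step_zero q 1 hi (by decide)

theorem mem_atom {hn : 4 ≤ n} (S : Set (Fin n)) (x : List (Fin 5)) :
    x ∈ atomInt (stateLang (D6 n hn)) S ↔
      ∀ i, ((D6 n hn).evalFrom i x ∈ (D6 n hn).accept ↔ i ∈ S) := by
  constructor
  · intro h i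
    exact ⟨fun h1 => by_contra fun h2 => (h i).2 h2 h1, (h i).1⟩
  · intro h i
    exact ⟨(h i).2, fun h1 h2 => h1 ((h i).1 h2)⟩

theorem mem_lq {hn : 4 ≤ n} (S : Set (Fin n)) (w x : List (Fin 5)) :
    x ∈ leftQuot w (atomInt (stateLang (D6 n hn)) S) ↔
      ∀ i, ((D6 n hn).evalFrom ((D6 n hn).evalFrom i w) x ∈ (D6 n hn).accept ↔ i ∈ S) := by
  change w ++ x ∈ atomInt (stateLang (D6 n hn)) S ↔ _
  rw [mem_atom]
  simp only [ev_app]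

theorem e_zero (hn : 4 ≤ n) (q : Fin n) (hq : q.val = 0) :
    (D6 n hn).evalFrom q [4] ∈ (D6 n hn).accept := by
  rw [ev_cons, ev_nil, acc_iff, step_e0 q hq]; omega

theorem e_nonzero (hn : 4 ≤ n) (q : Fin n) (hq : q.val ≠ 0) (x : List (Fin 5)) :
    (D6 n hn).evalFrom q (4 :: x) ∉ (D6 n hn).accept := by
  rw [ev_cons]; exact sink_not _ _ (step_e q hq)

/-! The number of atoms -/

theorem atoms_set (hn : 4 ≤ n) : {S : Set (Fin n) | atomInt (stateLang (D6 n hn)) S ≠ ∅} =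
    insert {⟨0, by omega⟩} ((fun U : Finset (Fin n) => (U : Set (Fin n))) '' (Md n).powerset) := by
  classical
  ext S
  simp only [Set.mem_ofPred_eq, ← Set.nonempty_iff_ne_empty, Set.mem_insert_iff, Set.mem_image,
    Finset.mem_coe, Finset.mem_powerset]
  constructor
  · rintro ⟨w, hw⟩
    rw [mem_atom] at hw
    by_cases h0 : (⟨0, by omega⟩ : Fin n) ∈ S
    · left
      ext q
      rw [Set.mem_singleton_iff]
      constructor
      · intro hq
        by_contra hne
        have hq0 : q.val ≠ 0 := fun h => hne (Fin.ext h)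
        exact zero_excl q _ w hq0 rfl ((hw q).2 hq) ((hw _).2 h0)
      · rintro rfl; exact h0
    · right
      refine ⟨S.toFinset, ?_, by simp⟩
      intro q hq
      rw [Set.mem_toFinset] at hq
      rw [mem_Md]
      have h1 : q.val ≠ 0 := fun h => h0 (by convert hq; exact h.symm)
      have h2 : q.val ≠ n - 1 := fun h => sink_not q w h ((hw q).2 hq)
      omega
  · rintro (rfl | ⟨U, hU, rfl⟩)
    · refine ⟨[4], ?_⟩
      rw [mem_atom]
      intro i
      rw [Set.mem_singleton_iff]
      constructor
      · intro h
        by_contra h2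
        exact e_nonzero hn i (fun h => h2 (Fin.ext h)) [] h
      · rintro rfl; exact e_zero hn _ rfl
    · exact sep' hn U hU

theorem atoms_card (hn : 4 ≤ n) :
    {S : Set (Fin n) | atomInt (stateLang (D6 n hn)) S ≠ ∅}.ncard = 2 ^ (n - 2) + 1 := by
  rw [atoms_set hn, Set.ncard_insert_of_notMem _ (Set.toFinite _), Set.ncard_image_of_injective,
    Set.ncard_coe_finset, Finset.card_powerset, card_Md hn]
  · exact fun _ _ h => Finset.coe_injective h
  · rintro ⟨U, hU, h⟩
    have h : (U : Set (Fin n)) = {⟨0, by omega⟩} := h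
    have h1 : (⟨0, by omega⟩ : Fin n) ∈ (U : Set (Fin n)) := by rw [h]; rfl
    have := (mem_Md _).1 (Finset.mem_powerset.1 hU h1)
    simp at this

/-! The atom of `{0}` -/

theorem stateLang_inj (hn : 4 ≤ n) : Function.Injective (stateLang (D6 n hn)) := by
  have key : ∀ p q : Fin n, stateLang (D6 n hn) p = stateLang (D6 n hn) q →
      p.val ≠ 0 → q.val ≠ 0 → p ∈ Md n → p = q := by
    intro p q h hp hq hm
    obtain ⟨w, hw⟩ := sep hn {p} (by simpa using hm)
    have h1 : w ∈ stateLang (D6 n hn) p := (hw p hp).2 (by simp)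
    rw [h] at h1
    exact (Finset.mem_singleton.1 ((hw q hq).1 h1)).symm
  have key0 : ∀ p q : Fin n, stateLang (D6 n hn) p = stateLang (D6 n hn) q →
      p.val = 0 → q.val = 0 := by
    intro p q h hp
    by_contra hq
    have h1 : [4] ∈ stateLang (D6 n hn) p := e_zero hn p hp
    rw [h] at h1
    exact e_nonzero hn q hq [] h1
  intro p q h
  have := p.isLt
  have := q.isLt
  by_cases hp : p.val = 0
  · exact Fin.ext (by rw [hp, key0 p q h hp])
  by_cases hq : q.val = 0
  · exact absurd (key0 q p h.symm hq) hp
  by_cases hpm : p ∈ Md n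
  · exact key p q h hp hq hpm
  by_cases hqm : q ∈ Md n
  · exact (key q p h.symm hq hp hqm).symm
  rw [mem_Md] at hpm hqm
  apply Fin.ext; omega

theorem lq_zero (hn : 4 ≤ n) (w : List (Fin 5)) :
    leftQuot w (atomInt (stateLang (D6 n hn)) {⟨0, by omega⟩}) =
      stateLang (D6 n hn) ((D6 n hn).evalFrom ⟨0, by omega⟩ w) := by
  ext x
  rw [mem_lq]
  constructor
  · intro h; exact (h _).2 rfl
  · intro h i
    rw [Set.mem_singleton_iff]
    constructor
    · intro h2
      by_contra h3
      rw [← ev_app] at h2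
      refine zero_excl i ⟨0, by omega⟩ _ (fun h => h3 (Fin.ext h)) rfl h2 ?_
      rw [ev_app]; exact h
    · rintro rfl; exact h

theorem quot_zero (hn : 4 ≤ n) :
    quotComp (atomInt (stateLang (D6 n hn)) {⟨0, by omega⟩}) = n := by
  have : {K : Set (List (Fin 5)) | ∃ w, K =
      leftQuot w (atomInt (stateLang (D6 n hn)) {⟨0, by omega⟩})} =
      Set.range (stateLang (D6 n hn)) := by
    ext K
    simp only [Set.mem_ofPred_eq, lq_zero, Set.mem_range]
    constructor
    · rintro ⟨w, rfl⟩; exact ⟨_, rfl⟩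
    · rintro ⟨q, rfl⟩
      by_cases hq : q.val = 0
      · exact ⟨[], by rw [ev_nil]; congr 1; exact Fin.ext hq⟩
      · obtain ⟨w, hw, -⟩ := exists_word hn
          (fun p => if p.val = n - 1 then p else q) (by intro p hp; simp [hp]) (by
            intro p hp; split_ifs <;> omega)
        refine ⟨4 :: w, ?_⟩
        have h1 := step_e0 (hn := hn) ⟨0, by omega⟩ rfl
        rw [ev_cons, hw _ (by omega), if_neg (by omega)]
  rw [quotComp, this, ← Set.image_univ, Set.ncard_image_of_injective _ (stateLang_inj hn),
    Set.ncard_univ, Nat.card_eq_fintype_card, Fintype.card_fin]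

/-! The atom of `∅` -/

def BL (n : ℕ) (hn : 4 ≤ n) (R : Finset (Fin n)) : Set (List (Fin 5)) :=
  {x | ∀ r ∈ R, (D6 n hn).evalFrom r x ∉ (D6 n hn).accept}

theorem quot_empty (hn : 4 ≤ n) :
    quotComp (atomInt (stateLang (D6 n hn)) (∅ : Set (Fin n))) = 2 ^ (n - 2) + 1 := by
  classical
  have : {K : Set (List (Fin 5)) | ∃ w, K =
      leftQuot w (atomInt (stateLang (D6 n hn)) (∅ : Set (Fin n)))} =
      insert (atomInt (stateLang (D6 n hn)) (∅ : Set (Fin n))) (BL n hn '' (Md n).powerset) := by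
    ext K
    simp only [Set.mem_ofPred_eq, Set.mem_insert_iff, Set.mem_image, Finset.mem_coe,
      Finset.mem_powerset]
    constructor
    · rintro ⟨w, rfl⟩
      by_cases hw : w = []
      · left; subst hw; rfl
      · right
        refine ⟨(Finset.univ.image fun i => (D6 n hn).evalFrom i w) ∩ Md n,
          Finset.inter_subset_right, ?_⟩
        ext x
        rw [mem_lq]
        simp only [Set.mem_empty_iff_false, iff_false]
        constructor
        · intro h i
          by_cases hm : (D6 n hn).evalFrom i w ∈ Md n
          · exact h _ (by simp only [Finset.mem_inter, hm, and_true]; simp)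
          · apply sink_not
            have h0 : ((D6 n hn).evalFrom i w).val ≠ 0 := by
              by_cases hi : i.val = 0
              · cases w with
                | nil => exact absurd rfl hw
                | cons y w =>
                  rw [ev_cons]
                  apply ev_ne
                  by_cases hy : y = 4
                  · rw [hy, step_e0 i hi]; omega
                  · rw [step_zero i y hi hy]; omega
              · exact ev_ne _ _ hi
            rw [mem_Md] at hm
            have := ((D6 n hn).evalFrom i w).isLt
            omega
        · intro h r hr
          simp only [Finset.mem_inter, Finset.mem_image, Finset.mem_univ, true_and] at hr
          obtain ⟨⟨i, rfl⟩, -⟩ := hr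
          exact h i
    · rintro (rfl | ⟨R, hR, rfl⟩)
      · exact ⟨[], rfl⟩
      · obtain ⟨w, hw, hw0⟩ := exists_word hn
          (fun q => if q ∈ R then q else ⟨n - 1, by omega⟩) (by
            intro q hq
            split_ifs
            · rfl
            · exact Fin.ext hq.symm) (by
            intro q hq
            split_ifs
            · exact hq
            · simp; omega)
        refine ⟨w, ?_⟩
        ext x
        rw [mem_lq]
        simp only [Set.mem_empty_iff_false, iff_false]
        constructor
        · intro h i
          by_cases hi : i.val = 0
          · exact sink_not _ _ (hw0 i hi)
          · rw [hw i hi]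
            split_ifs with hr
            · exact h i hr
            · exact sink_not _ _ rfl
        · intro h r hr
          have hm := (mem_Md r).1 (hR hr)
          have := h r
          rwa [hw r (by omega), if_pos hr] at this
  rw [quotComp, this, Set.ncard_insert_of_notMem _ (Set.toFinite _), Set.ncard_image_of_injOn,
    Set.ncard_coe_finset, Finset.card_powerset, card_Md hn]
  · have key : ∀ R ⊆ Md n, ∀ R' ⊆ Md n, BL n hn R = BL n hn R' → R ⊆ R' := by
      intro R hR R' hR' h q hq
      by_contra hq'
      obtain ⟨w, hw⟩ := sep hn {q} (by simpa using hR hq)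
      have h1 : w ∈ BL n hn R' := by
        intro r hr
        have := (mem_Md r).1 (hR' hr)
        rw [hw r (by omega), Finset.mem_singleton]
        rintro rfl; exact hq' hr
      rw [← h] at h1
      have := (mem_Md q).1 (hR hq)
      exact h1 q hq ((hw q (by omega)).2 (by simp))
    intro R hR R' hR' h
    rw [Finset.mem_coe, Finset.mem_powerset] at hR hR'
    exact (key R hR R' hR' h).antisymm (key R' hR' R hR h.symm)
  · rintro ⟨R, hR, h⟩
    rw [Finset.mem_coe, Finset.mem_powerset] at hR
    have h1 : [4] ∈ BL n hn R := by
      intro r hr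
      have := (mem_Md r).1 (hR hr)
      exact e_nonzero hn r (by omega) []
    rw [h, mem_atom] at h1
    exact ((h1 ⟨0, by omega⟩).1 (e_zero hn _ rfl))

/-! The general atoms -/

def CL (n : ℕ) (hn : 4 ≤ n) (t : (_ : Finset (Fin n)) × Finset (Fin n)) : Set (List (Fin 5)) :=
  {x | (∀ p ∈ t.1, (D6 n hn).evalFrom p x ∈ (D6 n hn).accept) ∧
    ∀ r ∈ t.2, (D6 n hn).evalFrom r x ∉ (D6 n hn).accept}

def TT (n s : ℕ) : Finset ((_ : Finset (Fin n)) × Finset (Fin n)) :=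
  ((Md n).powerset.filter fun P => P.card ∈ Finset.Icc 1 s).sigma fun P =>
    (Md n \ P).powerset.filter fun R => R.card ∈ Finset.Icc 0 (n - 2 - s)

theorem mem_TT (s : ℕ) (P R : Finset (Fin n)) : (⟨P, R⟩ : (_ : Finset (Fin n)) × Finset (Fin n)) ∈
    TT n s ↔ P ⊆ Md n ∧ 1 ≤ P.card ∧ P.card ≤ s ∧ R ⊆ Md n ∧ Disjoint R P ∧ R.card ≤ n - 2 - s := by
  simp [TT, Finset.subset_sdiff, and_assoc]

theorem sum_powerset_filter {α : Type} [DecidableEq α] (X : Finset α) (I : Finset ℕ) (g : ℕ → ℕ) :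
    ∑ P ∈ X.powerset.filter (fun P => P.card ∈ I), g P.card =
      ∑ y ∈ I, Nat.choose X.card y * g y := by
  rw [← Finset.sum_fiberwise_of_maps_to (t := I) (g := Finset.card)
    (fun P hP => (Finset.mem_filter.1 hP).2)]
  refine Finset.sum_congr rfl fun y hy => ?_
  have : (X.powerset.filter (fun P => P.card ∈ I)).filter (fun P => P.card = y) =
      Finset.powersetCard y X := by
    ext P
    simp only [Finset.mem_filter, Finset.mem_powerset, Finset.mem_powersetCard]
    constructor
    · rintro ⟨⟨h1, h2⟩, h3⟩; exact ⟨h1, h3⟩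
    · rintro ⟨h1, h3⟩; exact ⟨⟨h1, h3 ▸ hy⟩, h3⟩
  rw [this, Finset.sum_congr rfl (g := fun _ => g y)
    (fun P hP => by rw [(Finset.mem_powersetCard.1 hP).2]), Finset.sum_const,
    Finset.card_powersetCard, smul_eq_mul]

theorem card_TT (hn : 4 ≤ n) (s : ℕ) : (TT n s).card =
    ∑ x ∈ Finset.Icc 1 s, ∑ y ∈ Finset.Icc 0 (n - 2 - s),
          Nat.choose (n - 2) x * Nat.choose (n - 2 - x) y := by
  rw [TT, Finset.card_sigma]
  have h : ∀ P ∈ (Md n).powerset.filter (fun P => P.card ∈ Finset.Icc 1 s),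
      ((Md n \ P).powerset.filter fun R => R.card ∈ Finset.Icc 0 (n - 2 - s)).card =
      (fun x => ∑ y ∈ Finset.Icc 0 (n - 2 - s), Nat.choose (n - 2 - x) y) P.card := by
    intro P hP
    have hP := Finset.mem_powerset.1 (Finset.mem_filter.1 hP).1
    have h1 := sum_powerset_filter (Md n \ P) (Finset.Icc 0 (n - 2 - s)) (fun _ => 1)
    rw [← Finset.card_eq_sum_ones] at h1
    rw [h1, Finset.card_sdiff_of_subset hP, card_Md hn]
    simp
  rw [Finset.sum_congr rfl h, sum_powerset_filter (Md n) (Finset.Icc 1 s)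
    (fun x => ∑ y ∈ Finset.Icc 0 (n - 2 - s), Nat.choose (n - 2 - x) y), card_Md hn]
  exact Finset.sum_congr rfl fun x _ => by rw [Finset.mul_sum]

theorem CL_sep (hn : 4 ≤ n) (s : ℕ) (P R P' R' : Finset (Fin n))
    (h : (⟨P, R⟩ : (_ : Finset (Fin n)) × Finset (Fin n)) ∈ TT n s)
    (h' : (⟨P', R'⟩ : (_ : Finset (Fin n)) × Finset (Fin n)) ∈ TT n s)
    (he : CL n hn ⟨P, R⟩ = CL n hn ⟨P', R'⟩) : P' ⊆ P ∧ R' ⊆ R := by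
  rw [mem_TT] at h h'
  obtain ⟨hP, -, -, hR, hd, -⟩ := h
  obtain ⟨hP', -, -, hR', hd', -⟩ := h'
  have nz : ∀ q ∈ Md n, q.val ≠ 0 := fun q hq => by have := (mem_Md q).1 hq; omega
  constructor
  · obtain ⟨w, hw⟩ := sep hn P hP
    have h1 : w ∈ CL n hn ⟨P, R⟩ :=
      ⟨fun p hp => (hw p (nz p (hP hp))).2 hp, fun r hr h =>
        Finset.disjoint_left.1 hd hr ((hw r (nz r (hR hr))).1 h)⟩
    rw [he] at h1
    exact fun p hp => (hw p (nz p (hP' hp))).1 (h1.1 p hp)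
  · obtain ⟨w, hw⟩ := sep hn (Md n \ R) Finset.sdiff_subset
    have h1 : w ∈ CL n hn ⟨P, R⟩ :=
      ⟨fun p hp => (hw p (nz p (hP hp))).2 (Finset.mem_sdiff.2 ⟨hP hp, fun hr =>
        Finset.disjoint_left.1 hd hr hp⟩), fun r hr h =>
        (Finset.mem_sdiff.1 ((hw r (nz r (hR hr))).1 h)).2 hr⟩
    rw [he] at h1
    intro r hr
    by_contra hc
    exact h1.2 r hr ((hw r (nz r (hR' hr))).2 (Finset.mem_sdiff.2 ⟨hR' hr, hc⟩))

theorem CL_inj (hn : 4 ≤ n) (s : ℕ) : Set.InjOn (CL n hn) (TT n s) := by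
  rintro ⟨P, R⟩ h ⟨P', R'⟩ h' he
  have h1 := CL_sep hn s P R P' R' h h' he
  have h2 := CL_sep hn s P' R' P R h' h he.symm
  rw [h1.1.antisymm h2.1, h1.2.antisymm h2.2]

theorem CL_nonempty (hn : 4 ≤ n) (s : ℕ) (P R : Finset (Fin n))
    (h : (⟨P, R⟩ : (_ : Finset (Fin n)) × Finset (Fin n)) ∈ TT n s) : CL n hn ⟨P, R⟩ ≠ ∅ := by
  rw [mem_TT] at h
  obtain ⟨hP, -, -, hR, hd, -⟩ := h
  have nz : ∀ q ∈ Md n, q.val ≠ 0 := fun q hq => by have := (mem_Md q).1 hq; omega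
  obtain ⟨w, hw⟩ := sep hn P hP
  exact Set.nonempty_iff_ne_empty.1 ⟨w, fun p hp => (hw p (nz p (hP hp))).2 hp, fun r hr h =>
        Finset.disjoint_left.1 hd hr ((hw r (nz r (hR hr))).1 h)⟩

theorem exists_surj {α : Type} [DecidableEq α] (A B : Finset α) (h : B.card ≤ A.card) (z : α) :
    ∃ g : α → α, (∀ a, g a ∈ B ∨ g a = z) ∧ ∀ b ∈ B, ∃ a ∈ A, g a = b := by
  obtain ⟨A', hA', hc⟩ := Finset.exists_subset_card_eq h
  let e := Finset.equivOfCardEq hc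
  refine ⟨fun a => if ha : a ∈ A' then (e ⟨a, ha⟩ : α) else z, fun a => ?_, fun b hb => ?_⟩
  · dsimp only
    split_ifs with ha
    · left; exact (e ⟨a, ha⟩).2
    · right; rfl
  · refine ⟨(e.symm ⟨b, hb⟩ : α), hA' (e.symm ⟨b, hb⟩).2, ?_⟩
    simp

theorem quot_mid (hn : 4 ≤ n) (S : Finset (Fin n)) (hS : S.Nonempty) (hSM : S ⊆ Md n) :
    quotComp (atomInt (stateLang (D6 n hn)) (S : Set (Fin n))) = 1 + (TT n S.card).card := by
  classical
  have nz : ∀ q ∈ Md n, q.val ≠ 0 := fun q hq => by have := (mem_Md q).1 hq; omega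
  obtain ⟨i0, hi0⟩ := hS
  have : {K : Set (List (Fin 5)) | ∃ w, K =
      leftQuot w (atomInt (stateLang (D6 n hn)) (S : Set (Fin n)))} =
      insert ∅ (CL n hn '' (TT n S.card)) := by
    ext K
    simp only [Set.mem_ofPred_eq, Set.mem_insert_iff, Set.mem_image, Finset.mem_coe]
    constructor
    · rintro ⟨w, rfl⟩
      rw [or_iff_not_imp_left]
      intro hne
      obtain ⟨x, hx⟩ := Set.nonempty_iff_ne_empty.2 hne
      rw [mem_lq] at hx
      refine ⟨⟨S.image fun i => (D6 n hn).evalFrom i w,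
        ((Md n \ S).image fun i => (D6 n hn).evalFrom i w) ∩ Md n⟩, ?_, ?_⟩
      · rw [mem_TT]
        refine ⟨?_, ?_, Finset.card_image_le, Finset.inter_subset_right, ?_, ?_⟩
        · intro q hq
          obtain ⟨i, hi, rfl⟩ := Finset.mem_image.1 hq
          have h1 := ev_ne (hn := hn) w i (nz i (hSM hi))
          have h2 : ((D6 n hn).evalFrom i w).val ≠ n - 1 := fun h =>
            sink_not _ x h ((hx i).2 hi)
          have := ((D6 n hn).evalFrom i w).isLt
          rw [mem_Md]; omega
        · rw [Nat.succ_le_iff, Finset.card_pos]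
          exact ⟨_, Finset.mem_image_of_mem _ hi0⟩
        · rw [Finset.disjoint_left]
          intro q hq hq'
          obtain ⟨i, hi, hiq⟩ := Finset.mem_image.1 (Finset.mem_inter.1 hq).1
          obtain ⟨j, hj, hjq⟩ := Finset.mem_image.1 hq'
          have h1 := (hx j).2 hj
          rw [hjq, ← hiq] at h1
          exact (Finset.mem_sdiff.1 hi).2 ((hx i).1 h1)
        · refine (Finset.card_le_card Finset.inter_subset_left).trans
            (Finset.card_image_le.trans ?_)
          rw [Finset.card_sdiff_of_subset hSM, card_Md hn]
      · ext y
        rw [mem_lq]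
        constructor
        · rintro ⟨h1, h2⟩ i
          have hS1 : ∀ i ∈ S, (D6 n hn).evalFrom ((D6 n hn).evalFrom i w) y ∈ (D6 n hn).accept :=
            fun i hi => h1 _ (Finset.mem_image_of_mem _ hi)
          refine ⟨fun h => ?_, fun h => hS1 i h⟩
          by_contra hiS
          by_cases hi : i.val = 0
          · have := hS1 i0 hi0
            rw [← ev_app] at h this
            exact zero_excl i0 i _ (nz _ (hSM hi0)) hi this h
          · have e1 := ev_ne (hn := hn) w i hi
            have e2 : ((D6 n hn).evalFrom i w).val ≠ n - 1 := fun h' => sink_not _ y h' h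
            have e3 : i.val ≠ n - 1 := fun h' => by rw [ev_sink w i h'] at e2; exact e2 h'
            have l1 := ((D6 n hn).evalFrom i w).isLt
            have l2 := i.isLt
            refine h2 _ (Finset.mem_inter.2 ⟨Finset.mem_image_of_mem _ ?_, ?_⟩) h
            · exact Finset.mem_sdiff.2 ⟨(mem_Md i).2 (by omega), hiS⟩
            · exact (mem_Md _).2 (by omega)
        · intro h
          constructor
          · intro p hp
            obtain ⟨i, hi, rfl⟩ := Finset.mem_image.1 hp
            exact (h i).2 hi
          · intro r hr hr'
            obtain ⟨i, hi, rfl⟩ := Finset.mem_image.1 (Finset.mem_inter.1 hr).1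
            exact (Finset.mem_sdiff.1 hi).2 ((h i).1 hr')
    · rintro (rfl | ⟨⟨P, R⟩, h, rfl⟩)
      · refine ⟨[4], ?_⟩
        symm
        rw [Set.eq_empty_iff_forall_notMem]
        intro x hx
        have := ((mem_lq _ _ _).1 hx i0).2 hi0
        rw [← ev_app] at this
        exact e_nonzero hn i0 (nz _ (hSM hi0)) _ this
      · rw [mem_TT] at h
        obtain ⟨hP, hP1, hPs, hR, hd, hRs⟩ := h
        obtain ⟨p0, hp0⟩ := Finset.card_pos.1 hP1
        obtain ⟨g, hg, hg'⟩ := exists_surj S P hPs p0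
        obtain ⟨k, hk, hk'⟩ := exists_surj (Md n \ S) R
          (by rw [Finset.card_sdiff_of_subset hSM, card_Md hn]; exact hRs) ⟨n - 1, by omega⟩
        have hg : ∀ a, g a ∈ P := fun a => (hg a).elim id fun h => h ▸ hp0
        obtain ⟨w, hw, hw0⟩ := exists_word hn
          (fun q => if q ∈ S then g q else if q ∈ Md n then k q else ⟨n - 1, by omega⟩) (by
            intro q hq
            have h1 : q ∉ Md n := fun h => by have := (mem_Md q).1 h; omega
            have h2 : q ∉ S := fun h => h1 (hSM h)
            simp only [h1, h2, if_false]
            exact Fin.ext hq.symm) (by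
            intro q hq
            split_ifs
            · exact nz _ (hP (hg q))
            · rcases hk q with h | h
              · exact nz _ (hR h)
              · rw [h]; simp; omega
            · simp; omega)
        refine ⟨w, ?_⟩
        have hwS : ∀ i ∈ S, (D6 n hn).evalFrom i w = g i := fun i hi => by
          rw [hw i (nz i (hSM hi)), if_pos hi]
        have hwk : ∀ i ∈ Md n \ S, (D6 n hn).evalFrom i w = k i := fun i hi => by
          obtain ⟨h1, h2⟩ := Finset.mem_sdiff.1 hi
          rw [hw i (nz i h1), if_neg h2, if_pos h1]
        ext y
        rw [mem_lq]
        constructor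
        · rintro ⟨h1, h2⟩ i
          constructor
          · intro h
            by_contra hiS
            have hiS : i ∉ S := hiS
            by_cases hi : i.val = 0
            · exact sink_not _ _ (hw0 i hi) h
            · by_cases him : i ∈ Md n
              · rw [hwk i (Finset.mem_sdiff.2 ⟨him, hiS⟩)] at h
                rcases hk i with h3 | h3
                · exact h2 _ h3 h
                · rw [h3] at h; exact sink_not _ _ rfl h
              · rw [hw i hi, if_neg hiS, if_neg him] at h
                exact sink_not _ _ rfl h
          · intro hi
            rw [hwS i hi]
            exact h1 _ (hg i)
        · intro h
          constructor
          · intro p hp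
            obtain ⟨i, hi, rfl⟩ := hg' p hp
            rw [← hwS i hi]
            exact (h i).2 hi
          · intro r hr hr'
            obtain ⟨i, hi, rfl⟩ := hk' r hr
            rw [← hwk i hi] at hr'
            exact (Finset.mem_sdiff.1 hi).2 ((h i).1 hr')
  rw [quotComp, this, Set.ncard_insert_of_notMem _ (Set.toFinite _),
    Set.ncard_image_of_injOn (CL_inj hn _), Set.ncard_coe_finset, add_comm]
  rintro ⟨⟨P, R⟩, h, h'⟩
  exact CL_nonempty hn _ P R h h'

end counting

/-- For `n ≥ 4`, the language of `D_n(a,b,c,d,e)`, with quotients `K_q` the state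
languages (so `K_0 = L` and `K_{n−1} = ∅`), meets the bounds for atoms: `A_∅` is an
atom with `κ(A_∅) = 2^{n−2} + 1`; `A_{{0}}` is an atom with `κ(A_{{0}}) = n`; for
every nonempty `S ⊆ {1,…,n−2}`, `A_S` is an atom with
`κ(A_S) = 1 + Σ_{x=1}^{|S|} Σ_{y=0}^{n−2−|S|} C(n−2,x)·C(n−2−x,y)`; and `L` has
exactly `2^{n−2} + 1` atoms. -/
theorem stmt17 (n : ℕ) (hn : 4 ≤ n) :
    (atomInt (stateLang (D6 n hn)) (∅ : Set (Fin n)) ≠ ∅ ∧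
      quotComp (atomInt (stateLang (D6 n hn)) (∅ : Set (Fin n))) = 2 ^ (n - 2) + 1) ∧
    (atomInt (stateLang (D6 n hn)) {⟨0, by omega⟩} ≠ ∅ ∧
      quotComp (atomInt (stateLang (D6 n hn)) {⟨0, by omega⟩}) = n) ∧
    (∀ S : Set (Fin n), S ≠ ∅ → (∀ i ∈ S, 0 < i.val ∧ i.val < n - 1) →
      atomInt (stateLang (D6 n hn)) S ≠ ∅ ∧
      quotComp (atomInt (stateLang (D6 n hn)) S) =
        1 + ∑ x ∈ Finset.Icc 1 S.ncard, ∑ y ∈ Finset.Icc 0 (n - 2 - S.ncard),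
          Nat.choose (n - 2) x * Nat.choose (n - 2 - x) y) ∧
    {S : Set (Fin n) | atomInt (stateLang (D6 n hn)) S ≠ ∅}.ncard = 2 ^ (n - 2) + 1 := by
  classical
  have h0 : atomInt (stateLang (D6 n hn)) {⟨0, by omega⟩} ≠ ∅ := by
    have : ({⟨0, by omega⟩} : Set (Fin n)) ∈
        {S : Set (Fin n) | atomInt (stateLang (D6 n hn)) S ≠ ∅} := by
      rw [atoms_set hn]; exact Set.mem_insert _ _
    exact this
  refine ⟨⟨?_, quot_empty hn⟩, ⟨h0, quot_zero hn⟩, ?_, atoms_card hn⟩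
  · have := sep' hn ∅ (by simp)
    rw [Finset.coe_empty] at this
    exact Set.nonempty_iff_ne_empty.1 this
  · intro S hS hSM
    have hsub : S.toFinset ⊆ Md n := fun i hi => (mem_Md i).2 (hSM i (Set.mem_toFinset.1 hi))
    have h1 := sep' hn S.toFinset hsub
    have h2 := quot_mid hn S.toFinset
      (by rwa [Set.toFinset_nonempty, Set.nonempty_iff_ne_empty]) hsub
    rw [Set.coe_toFinset] at h1 h2
    rw [card_TT hn, ← Set.ncard_eq_toFinset_card'] at h2
    exact ⟨Set.nonempty_iff_ne_empty.1 h1, h2⟩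
end
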